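/- Let τ be in the complex upper half-plane and let u ∈ ℂ with u ∉ 2ℤτ + ℤ. Then ϑ(u;2τ)³ · (2πi ∂/∂τ + ∂²/∂u²)[ e^{−πiτ/2} e^{πiu} μ(u, τ; 2τ) ] = −4π² ( η(2τ)⁸ / η(τ) ) ϑ(u + 1/2; τ), where the differential operator is applied to the bracketed expression as a function of (u,τ). -/

import Mathlib

open Complex Real Filter

noncomputable section

/-- The Jacobi theta function ϑ(u;τ) = Σ_{ν∈ℤ+1/2} e^{πiν²τ + 2πiν(u+1/2)}. -/
def jTheta (u τ : ℂ) : ℂ :=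
  ∑' n : ℤ, Complex.exp (π * I * ((n : ℂ) + 1/2)^2 * τ + 2 * π * I * ((n : ℂ) + 1/2) * (u + 1/2))

/-- ϑ₀(u;τ) = Σ_{n∈ℤ} e^{πin²τ + 2πinu}. -/
def jTheta0 (u τ : ℂ) : ℂ :=
  ∑' n : ℤ, Complex.exp (π * I * (n : ℂ)^2 * τ + 2 * π * I * (n : ℂ) * u)

/-- ϑ₁(u;τ) = Σ_{n∈1/2+ℤ} e^{πin²τ + 2πinu}. -/
def jTheta1 (u τ : ℂ) : ℂ :=
  ∑' n : ℤ, Complex.exp (π * I * ((n : ℂ) + 1/2)^2 * τ + 2 * π * I * ((n : ℂ) + 1/2) * u)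

/-- The Dedekind eta function. -/
def dedekindEta (τ : ℂ) : ℂ :=
  Complex.exp (π * I * τ / 12) * ∏' n : ℕ, (1 - Complex.exp (2 * π * I * ((n : ℂ) + 1) * τ))

/-- The Lerch sum μ(u,v;τ). -/
def lerchMu (u v τ : ℂ) : ℂ :=
  Complex.exp (π * I * u) / jTheta v τ *
    ∑' n : ℤ, (-1 : ℂ) ^ n * Complex.exp (π * I * ((n : ℂ)^2 + (n : ℂ)) * τ + 2 * π * I * v * (n : ℂ)) /
      (1 - Complex.exp (2 * π * I * (n : ℂ) * τ + 2 * π * I * u))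

/-- a₀^{α,β}(τ). -/
def aCoef0 (α β : ℝ) (τ : ℂ) : ℂ :=
  ∑' n : ℤ, ((n : ℂ) + (α : ℂ)/2) *
    Complex.exp (2 * π * I * (n : ℂ)^2 * τ + 2 * π * I * (n : ℂ) * ((α : ℂ) * τ + (β : ℂ)))

/-- a₁^{α,β}(τ). -/
def aCoef1 (α β : ℝ) (τ : ℂ) : ℂ :=
  ∑' n : ℤ, (((n : ℂ) + 1/2) + (α : ℂ)/2) *
    Complex.exp (2 * π * I * ((n : ℂ) + 1/2)^2 * τ + 2 * π * I * ((n : ℂ) + 1/2) * ((α : ℂ) * τ + (β : ℂ)))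

/-- Finite q-Pochhammer symbol (a;q)_n. -/
def qPochN (a q : ℂ) (n : ℕ) : ℂ := ∏ j ∈ Finset.range n, (1 - a * q ^ j)

/-- Infinite q-Pochhammer symbol (a;q)_∞. -/
def qPochInf (a q : ℂ) : ℂ := ∏' j : ℕ, (1 - a * q ^ j)

/-- The modified rank generating function R*(z;q). -/
def rankStar (z q : ℂ) : ℂ :=
  (qPochInf q q)⁻¹ * ∑' n : ℤ, (-1 : ℂ) ^ n * q ^ (n * (3 * n + 1) / 2) / (1 - z * q ^ n)

/-- The modified crank generating function C*(z;q). -/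
def crankStar (z q : ℂ) : ℂ :=
  (1 - z)⁻¹ * ∏' n : ℕ, ((1 - q ^ (n + 1)) / ((1 - z * q ^ (n + 1)) * (1 - z⁻¹ * q ^ (n + 1))))

/-- N(1,0,z;q), the overpartition-rank generating function. -/
def nGen10 (z q : ℂ) : ℂ :=
  ∑' n : ℕ, qPochN (-1) q n * q ^ (n * (n + 1) / 2) / (qPochN (z * q) q n * qPochN (z⁻¹ * q) q n)

/-- N*(1,0,z;q). -/
def nStar10 (z q : ℂ) : ℂ := nGen10 z q / (1 - z)

/-- N(1,1/q,z;q²), the M2-rank generating function for overpartitions. -/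
def nGenM2over (z q : ℂ) : ℂ :=
  ∑' n : ℕ, qPochN (-1) (q^2) n * qPochN (-q) (q^2) n * q ^ n /
    (qPochN (z * q^2) (q^2) n * qPochN (z⁻¹ * q^2) (q^2) n)

/-- N*(1,1/q,z;q²). -/
def nStarM2over (z q : ℂ) : ℂ := nGenM2over z q / (1 - z)

/-- N(0,1/q,z;q²), the M2-rank generating function for partitions without repeated odd parts. -/
def nGenM2 (z q : ℂ) : ℂ :=
  ∑' n : ℕ, qPochN (-q) (q^2) n * q ^ (n^2) /
    (qPochN (z * q^2) (q^2) n * qPochN (z⁻¹ * q^2) (q^2) n)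

/-- N*(0,1/q,z;q²). -/
def nStarM2 (z q : ℂ) : ℂ := nGenM2 z q / (1 - z)

/-- The odd-rank generating function R^o(z;q). -/
def oddRank (z q : ℂ) : ℂ :=
  (qPochInf (q^2) (q^2))⁻¹ * ∑' n : ℤ, (-1 : ℂ) ^ n * q ^ (3 * n^2 + 3 * n + 1) / (1 - z * q ^ (2 * n + 1))

open Topology

/-- The reciprocal `1/(Q;Q)_m` of the finite `q`-Pochhammer symbol, extended by `0` to `m < 0`. -/
def recipPoch (Q : ℂ) : ℤ → ℂ
  | (m : ℕ) => (∏ k ∈ Finset.range m, (1 - Q ^ (k + 1)))⁻¹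
  | Int.negSucc _ => 0

lemma one_sub_pow_ne_zero_of_norm_lt_one {Q : ℂ} (hQ : ‖Q‖ < 1) (k : ℕ) : 1 - Q ^ (k + 1) ≠ 0 := by
  intro h
  have h1 : ‖Q ^ (k + 1)‖ = 1 := by rw [← sub_eq_zero.mp h]; simp
  rw [norm_pow] at h1
  exact absurd h1 (pow_lt_one₀ (norm_nonneg _) hQ (by simp)).ne

lemma recipPoch_sub_one {Q : ℂ} (hQ : ‖Q‖ < 1) (m : ℤ) :
    recipPoch Q (m - 1) = (1 - Q ^ m) * recipPoch Q m := by
  rcases m with m | m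
  · cases m with
    | zero =>
      change recipPoch Q (Int.negSucc 0) = _
      simp [recipPoch]
    | succ m =>
      have : Int.ofNat (m + 1) - 1 = Int.ofNat m := by simp
      rw [this]
      change (∏ k ∈ Finset.range m, (1 - Q ^ (k + 1)))⁻¹ =
        (1 - Q ^ ((m + 1 : ℕ) : ℤ)) * (∏ k ∈ Finset.range (m + 1), (1 - Q ^ (k + 1)))⁻¹
      have := one_sub_pow_ne_zero_of_norm_lt_one hQ m
      rw [Finset.prod_range_succ, zpow_natCast, mul_inv]
      field_simp
  · have : Int.negSucc m - 1 = Int.negSucc (m + 1) := by omega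
    rw [this]
    simp [recipPoch]

/-- The finite form of the Jacobi triple product identity. -/
lemma hasSum_finite_jacobi_triple_product {q z : ℂ} (hq : ‖q‖ < 1) (hq0 : q ≠ 0) (hz : z ≠ 0)
    (N : ℕ) :
    HasSum (fun j : ℤ => (q ^ (j ^ 2) * z ^ j) *
        ((∏ k ∈ Finset.range (2 * N), (1 - (q ^ 2) ^ (k + 1))) *
          (recipPoch (q ^ 2) (N - j) * recipPoch (q ^ 2) (N + j))))
      (∏ k ∈ Finset.range N, ((1 + q ^ (2 * k + 1) * z) * (1 + q ^ (2 * k + 1) * z⁻¹))) := by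
  have hQ : ‖q ^ 2‖ < 1 := by
    rw [norm_pow]; exact pow_lt_one₀ (norm_nonneg _) hq (by simp)
  induction N with
  | zero =>
    have h0 : ∀ j : ℤ, j ≠ 0 → recipPoch (q ^ 2) (-j) * recipPoch (q ^ 2) j = 0 := by
      intro j hj
      rcases lt_or_gt_of_ne hj with h | h
      · obtain ⟨m, rfl⟩ := Int.eq_negSucc_of_lt_zero h
        simp [recipPoch]
      · obtain ⟨m, hm⟩ := Int.eq_negSucc_of_lt_zero (show -j < 0 by omega)
        rw [hm]; simp [recipPoch]
    have := hasSum_ite_eq (0 : ℤ) (1 : ℂ)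
    simp only [Finset.range_zero, Finset.prod_empty, mul_zero, Nat.cast_zero, zero_sub, zero_add,
      one_mul]
    convert this using 2 with j
    split_ifs with h
    · subst h
      have h1 : recipPoch (q ^ 2) 0 = 1 := by
        change (∏ k ∈ Finset.range 0, (1 - (q ^ 2) ^ (k + 1)))⁻¹ = 1
        simp
      simp [h1]
    · rw [h0 j h, mul_zero]
  | succ N ih =>
    set Q := q ^ 2 with hQdef
    have hQ0 : Q ≠ 0 := pow_ne_zero _ hq0
    have e1 := ih.mul_left (1 + q ^ (4 * N + 2))
    have e2 := ((Equiv.subRight (1 : ℤ)).hasSum_iff.mpr ih).mul_left (q ^ (2 * N + 1) * z)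
    have e3 := ((Equiv.addRight (1 : ℤ)).hasSum_iff.mpr ih).mul_left (q ^ (2 * N + 1) * z⁻¹)
    have e := (e1.add e2).add e3
    rw [Finset.prod_range_succ]
    have hval : q ^ (4 * N + 2) = q ^ (2 * N + 1) * q ^ (2 * N + 1) := by ring
    have hprod : ∀ P : ℂ, P * ((1 + q ^ (2 * N + 1) * z) * (1 + q ^ (2 * N + 1) * z⁻¹)) =
        (1 + q ^ (4 * N + 2)) * P + q ^ (2 * N + 1) * z * P + q ^ (2 * N + 1) * z⁻¹ * P := by
      intro P
      rw [hval]
      field_simp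
      ring
    rw [hprod]
    refine e.congr_fun ?_
    · intro j
      simp only [Function.comp_apply, Equiv.subRight_apply, Equiv.coe_addRight]
      have a1 : ((N + 1 : ℕ) : ℤ) - j = (N + 1 - j) := by push_cast; ring
      have a2 : ((N + 1 : ℕ) : ℤ) + j = (N + 1 + j) := by push_cast; ring
      have a3 : (N : ℤ) - j = (N + 1 - j) - 1 := by ring
      have a4 : (N : ℤ) + j = (N + 1 + j) - 1 := by ring
      have a5 : (N : ℤ) - (j - 1) = (N + 1 - j) := by ring
      have a6 : (N : ℤ) + (j - 1) = (N + 1 + j) - 1 - 1 := by ring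
      have a7 : (N : ℤ) - (j + 1) = (N + 1 - j) - 1 - 1 := by ring
      have a8 : (N : ℤ) + (j + 1) = (N + 1 + j) := by ring
      rw [a1, a2, a3, a4, a5, a6, a7, a8]
      simp only [recipPoch_sub_one hQ]
      set A := recipPoch Q (N + 1 - j)
      set B := recipPoch Q (N + 1 + j)
      have p1 : Q ^ ((N : ℤ) + 1 - j - 1) = Q ^ ((N : ℤ) + 1 - j) / Q := by
        rw [zpow_sub_one₀ hQ0, div_eq_mul_inv]
      have p2 : Q ^ ((N : ℤ) + 1 + j - 1) = Q ^ ((N : ℤ) + 1 + j) / Q := by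
        rw [zpow_sub_one₀ hQ0, div_eq_mul_inv]
      rw [p1, p2]
      have p3 : 2 * (N + 1) = (2 * N + 1) + 1 := by ring
      rw [p3, Finset.prod_range_succ, Finset.prod_range_succ]
      set D := ∏ k ∈ Finset.range (2 * N), (1 - Q ^ (k + 1))
      have hqj : ∀ m : ℤ, Q ^ m = q ^ (2 * m) := by
        intro m; rw [hQdef, ← zpow_natCast, ← zpow_mul]; rfl
      have p4 : q ^ (2 * N + 1) * z * (q ^ ((j - 1) ^ 2) * z ^ (j - 1)) =
          Q ^ ((N : ℤ) + 1 - j) * (q ^ (j ^ 2) * z ^ j) := by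
        rw [hqj, zpow_sub_one₀ hz, ← zpow_natCast]
        have : q ^ (2 * ((N : ℤ) + 1 - j)) * q ^ (j ^ 2) =
            q ^ ((2 * N + 1 : ℕ) : ℤ) * q ^ ((j - 1) ^ 2) := by
          rw [← zpow_add₀ hq0, ← zpow_add₀ hq0]; congr 1; push_cast; ring
        field_simp
        rw [this]
      have p5 : q ^ (2 * N + 1) * z⁻¹ * (q ^ ((j + 1) ^ 2) * z ^ (j + 1)) =
          Q ^ ((N : ℤ) + 1 + j) * (q ^ (j ^ 2) * z ^ j) := by
        rw [hqj, zpow_add_one₀ hz, ← zpow_natCast]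
        have : q ^ (2 * ((N : ℤ) + 1 + j)) * q ^ (j ^ 2) =
            q ^ ((2 * N + 1 : ℕ) : ℤ) * q ^ ((j + 1) ^ 2) := by
          rw [← zpow_add₀ hq0, ← zpow_add₀ hq0]; congr 1; push_cast; ring
        field_simp
        rw [this]
      rw [← mul_assoc (q ^ (2 * N + 1) * z), ← mul_assoc (q ^ (2 * N + 1) * z⁻¹), p4, p5]
      have p6 : q ^ (4 * N + 2) = Q ^ ((N : ℤ) + 1 - j) * Q ^ ((N : ℤ) + 1 + j) / Q := by
        rw [← zpow_add₀ hQ0, div_eq_mul_inv, ← zpow_sub_one₀ hQ0, hqj, ← zpow_natCast]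
        congr 1; push_cast; ring
      have p7 : Q ^ (2 * N + 1) = Q ^ ((N : ℤ) + 1 - j) * Q ^ ((N : ℤ) + 1 + j) / Q := by
        rw [← zpow_add₀ hQ0, div_eq_mul_inv, ← zpow_sub_one₀ hQ0, ← zpow_natCast]
        congr 1; push_cast; ring
      have p8 : Q ^ (2 * N + 1 + 1) = Q ^ ((N : ℤ) + 1 - j) * Q ^ ((N : ℤ) + 1 + j) := by
        rw [← zpow_add₀ hQ0, ← zpow_natCast]
        congr 1; push_cast; ring
      rw [p6, p7, p8]
      field_simp
      ring

lemma norm_bounded_of_tendsto {f : ℕ → ℂ} {a : ℂ} (h : Tendsto f atTop (𝓝 a)) :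
    ∃ C, ∀ n, ‖f n‖ ≤ C := by
  obtain ⟨C, hC⟩ := (Metric.isBounded_range_of_tendsto f h).exists_norm_le
  exact ⟨C, fun n => hC _ ⟨n, rfl⟩⟩

lemma tprod_one_sub_pow_ne_zero {Q : ℂ} (hQ : ‖Q‖ < 1) : ∏' k : ℕ, (1 - Q ^ (k + 1)) ≠ 0 := by
  simp only [sub_eq_add_neg]
  refine tprod_one_add_ne_zero_of_summable (f := fun n : ℕ => -Q ^ (n + 1)) ?_ ?_
  · intro i
    simpa [sub_eq_add_neg] using one_sub_pow_ne_zero_of_norm_lt_one hQ i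
  · simpa using (summable_nat_add_iff 1).mpr (summable_geometric_of_lt_one (norm_nonneg _) hQ)

lemma multipliable_one_add_odd_pow_mul {q : ℂ} (hq : ‖q‖ < 1) (w : ℂ) :
    Multipliable fun k : ℕ => 1 + q ^ (2 * k + 1) * w := by
  apply multipliable_one_add_of_summable
  have h2 : ‖q ^ 2‖ < 1 := by
    rw [norm_pow]; exact pow_lt_one₀ (norm_nonneg _) hq (by simp)
  have := ((summable_geometric_of_lt_one (norm_nonneg _) h2).mul_left ‖q‖).mul_right ‖w‖
  refine this.congr fun k => ?_
  simp only [norm_mul, norm_pow]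
  ring

lemma summable_sq_zpow_mul_zpow {q z : ℂ} (hq : ‖q‖ < 1) (hq0 : q ≠ 0) (hz : z ≠ 0) :
    Summable fun j : ℤ => ‖q ^ (j ^ 2) * z ^ j‖ := by
  have hpi : (2 * π * I : ℂ) ≠ 0 := by simp [Real.pi_ne_zero]
  set t : ℂ := Complex.log q / (π * I) with ht
  set u : ℂ := Complex.log z / (2 * π * I) with hu
  have hpi2 : (π : ℂ) ≠ 0 := by simp [Real.pi_ne_zero]
  have him : 0 < t.im := by
    have h1 : Complex.log q = π * I * t := by rw [ht]; field_simp
    have h2 : (Complex.log q).re = -(π * t.im) := by rw [h1]; simp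
    rw [Complex.log_re] at h2
    have := Real.log_neg (norm_pos_iff.mpr hq0) hq
    have hp := Real.pi_pos
    by_contra hcon
    push Not at hcon
    nlinarith
  refine ((summable_jacobiTheta₂_term_iff u t).mpr him).norm.congr fun j => ?_
  rw [jacobiTheta₂_term, Complex.exp_add]
  have e1 : 2 * π * I * j * u = j * Complex.log z := by rw [hu]; field_simp
  have e2 : π * I * j ^ 2 * t = ((j ^ 2 : ℤ) : ℂ) * Complex.log q := by
    rw [ht]; push_cast; field_simp
  rw [e1, e2, Complex.exp_int_mul, Complex.exp_int_mul, Complex.exp_log hz, Complex.exp_log hq0,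
    mul_comm]

/-- The Jacobi triple product identity. -/
theorem hasSum_jacobi_triple_product {q z : ℂ} (hq : ‖q‖ < 1) (hq0 : q ≠ 0) (hz : z ≠ 0) :
    HasSum (fun j : ℤ => q ^ (j ^ 2) * z ^ j)
      ((∏' k : ℕ, (1 - (q ^ 2) ^ (k + 1))) *
        ((∏' k : ℕ, (1 + q ^ (2 * k + 1) * z)) * ∏' k : ℕ, (1 + q ^ (2 * k + 1) * z⁻¹))) := by
  have hQ : ‖q ^ 2‖ < 1 := by
    rw [norm_pow]; exact pow_lt_one₀ (norm_nonneg _) hq (by simp)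
  set E : ℂ := ∏' k : ℕ, (1 - (q ^ 2) ^ (k + 1)) with hE
  have hE0 : E ≠ 0 := tprod_one_sub_pow_ne_zero hQ
  have hP : Tendsto (fun N => ∏ k ∈ Finset.range N, (1 - (q ^ 2) ^ (k + 1))) atTop (𝓝 E) :=
    (ModularForm.multipliable_one_sub_pow hQ).hasProd.tendsto_prod_nat
  obtain ⟨C, hC⟩ := norm_bounded_of_tendsto hP
  obtain ⟨C', hC'⟩ := norm_bounded_of_tendsto (hP.inv₀ hE0)
  have hr : ∀ m, ‖recipPoch (q ^ 2) m‖ ≤ C' := by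
    rintro (m | m)
    · exact hC' m
    · simpa [recipPoch] using (norm_nonneg _).trans (hC' 0)
  have hC0 : 0 ≤ C := (norm_nonneg _).trans (hC 0)
  have hC'0 : 0 ≤ C' := (norm_nonneg _).trans (hC' 0)
  have hsum := summable_sq_zpow_mul_zpow hq hq0 hz
  have hrt : Tendsto (fun m : ℤ => recipPoch (q ^ 2) m) atTop (𝓝 E⁻¹) := by
    have h1 := (hP.inv₀ hE0).comp (tendsto_natCast_atTop_atTop (R := ℕ))
    have h2 : Tendsto (fun m : ℤ => (∏ k ∈ Finset.range m.toNat, (1 - (q ^ 2) ^ (k + 1)))⁻¹) atTop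
        (𝓝 E⁻¹) := (hP.inv₀ hE0).comp (tendsto_atTop.mpr fun b => by
          filter_upwards [eventually_ge_atTop (b : ℤ)] with a ha
          omega)
    refine h2.congr' ?_
    filter_upwards [eventually_ge_atTop (0 : ℤ)] with a ha
    obtain ⟨n, rfl⟩ := Int.eq_ofNat_of_zero_le ha
    rfl
  have key : Tendsto (fun N : ℕ => ∑' j : ℤ, (q ^ (j ^ 2) * z ^ j) *
        ((∏ k ∈ Finset.range (2 * N), (1 - (q ^ 2) ^ (k + 1))) *
          (recipPoch (q ^ 2) (N - j) * recipPoch (q ^ 2) (N + j)))) atTop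
      (𝓝 (∑' j : ℤ, (q ^ (j ^ 2) * z ^ j) * (E * (E⁻¹ * E⁻¹)))) := by
    refine tendsto_tsum_of_dominated_convergence
      (bound := fun j => ‖q ^ (j ^ 2) * z ^ j‖ * (C * (C' * C'))) (hsum.mul_right _) ?_ ?_
    · intro j
      refine tendsto_const_nhds.mul ((hP.comp ?_).mul ((hrt.comp ?_).mul (hrt.comp ?_)))
      · exact tendsto_id.const_mul_atTop' (by norm_num)
      · simpa [sub_eq_add_neg] using tendsto_atTop_add_const_right _ (-j)
          (tendsto_natCast_atTop_atTop (R := ℤ))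
      · exact tendsto_atTop_add_const_right _ j (tendsto_natCast_atTop_atTop (R := ℤ))
    · refine Eventually.of_forall fun N j => ?_
      rw [norm_mul]
      refine mul_le_mul_of_nonneg_left ?_ (norm_nonneg _)
      rw [norm_mul, norm_mul]
      gcongr
      · exact hC _
      · exact hr _
      · exact hr _
  have hprod : Tendsto (fun N => ∏ k ∈ Finset.range N,
      ((1 + q ^ (2 * k + 1) * z) * (1 + q ^ (2 * k + 1) * z⁻¹))) atTop
      (𝓝 ((∏' k : ℕ, (1 + q ^ (2 * k + 1) * z)) * ∏' k : ℕ, (1 + q ^ (2 * k + 1) * z⁻¹))) := by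
    simp only [Finset.prod_mul_distrib]
    exact (multipliable_one_add_odd_pow_mul hq z).hasProd.tendsto_prod_nat.mul
      (multipliable_one_add_odd_pow_mul hq z⁻¹).hasProd.tendsto_prod_nat
  have heq := tendsto_nhds_unique
    (key.congr fun N => (hasSum_finite_jacobi_triple_product hq hq0 hz N).tsum_eq) hprod
  rw [tsum_mul_right] at heq
  have hs : Summable fun j : ℤ => q ^ (j ^ 2) * z ^ j := hsum.of_norm
  convert hs.hasSum using 1
  rw [← heq]
  field_simp

/-- The infinite product `∏_{k ≥ 1} (1 - Q^k w)`. -/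
def eulerProd (Q w : ℂ) : ℂ := ∏' k : ℕ, (1 - Q ^ (k + 1) * w)

lemma summable_norm_pow_succ_mul {Q : ℂ} (hQ : ‖Q‖ < 1) (w : ℂ) :
    Summable fun k : ℕ => ‖-(Q ^ (k + 1) * w)‖ := by
  have := ((summable_nat_add_iff 1).mpr (summable_geometric_of_lt_one (norm_nonneg _) hQ)).mul_right
    ‖w‖
  refine this.congr fun k => ?_
  rw [norm_neg, norm_mul, norm_pow]

lemma multipliable_eulerProd {Q : ℂ} (hQ : ‖Q‖ < 1) (w : ℂ) :
    Multipliable fun k : ℕ => 1 - Q ^ (k + 1) * w := by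
  simp only [sub_eq_add_neg]
  exact multipliable_one_add_of_summable (summable_norm_pow_succ_mul hQ w)

lemma eulerProd_ne_zero {Q : ℂ} (hQ : ‖Q‖ < 1) {w : ℂ} (hw : ∀ k : ℕ, Q ^ (k + 1) * w ≠ 1) :
    eulerProd Q w ≠ 0 := by
  unfold eulerProd
  simp only [sub_eq_add_neg]
  refine tprod_one_add_ne_zero_of_summable (fun i => ?_) (summable_norm_pow_succ_mul hQ w)
  rw [← sub_eq_add_neg]
  exact sub_ne_zero.mpr (hw i).symm

lemma continuous_eulerProd {Q : ℂ} (hQ : ‖Q‖ < 1) : Continuous (eulerProd Q) := by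
  rw [continuous_iff_continuousAt]
  intro w
  have hs := ((summable_nat_add_iff 1).mpr
    (summable_geometric_of_lt_one (norm_nonneg _) hQ)).mul_right (‖w‖ + 1)
  have h := hs.hasProdLocallyUniformlyOn_nat_one_add (K := Metric.ball (0 : ℂ) (‖w‖ + 1))
    (f := fun k x => -(Q ^ (k + 1) * x)) Metric.isOpen_ball
    (Eventually.of_forall fun n x hx => by
      rw [norm_neg, norm_mul, norm_pow]
      gcongr
      exact (mem_ball_zero_iff.mp hx).le) (fun n => by fun_prop)
  have hc : ContinuousOn (fun x => ∏' k, (1 + -(Q ^ (k + 1) * x))) (Metric.ball (0 : ℂ) (‖w‖ + 1)) :=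
    TendstoLocallyUniformlyOn.continuousOn h (Frequently.of_forall fun s => by fun_prop)
  have := hc.continuousAt (Metric.isOpen_ball.mem_nhds (by simp : w ∈ Metric.ball 0 (‖w‖ + 1)))
  simpa [eulerProd, sub_eq_add_neg] using! this

lemma norm_sq_lt_one {q : ℂ} (hq : ‖q‖ < 1) : ‖q ^ 2‖ < 1 := by
  rw [norm_pow]; exact pow_lt_one₀ (norm_nonneg _) hq (by simp)

lemma eulerProd_one_ne_zero {Q : ℂ} (hQ : ‖Q‖ < 1) : eulerProd Q 1 ≠ 0 :=
  eulerProd_ne_zero hQ fun k h => one_sub_pow_ne_zero_of_norm_lt_one hQ k (by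
    rw [← h, mul_one, sub_self])

lemma eulerProd_one_eq_even_mul_odd {q : ℂ} (hq : ‖q‖ < 1) :
    eulerProd q 1 = eulerProd (q ^ 2) 1 * ∏' k : ℕ, (1 + q ^ (2 * k + 1) * (-1)) := by
  have he := multipliable_eulerProd (norm_sq_lt_one hq) 1
  have ho := multipliable_one_add_odd_pow_mul hq (-1)
  have h := tprod_even_mul_odd (f := fun k => 1 - q ^ (k + 1) * 1)
    (ho.congr fun k => by ring) (he.congr fun k => by ring_nf)
  unfold eulerProd
  rw [← h, mul_comm]
  congr 1
  · exact tprod_congr fun k => by ring_nf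
  · exact tprod_congr fun k => by ring_nf

lemma eulerProd_sq_one_eq_mul {q : ℂ} (hq : ‖q‖ < 1) :
    eulerProd (q ^ 2) 1 = eulerProd q 1 * eulerProd q (-1) := by
  unfold eulerProd
  rw [← (multipliable_eulerProd hq 1).tprod_mul (multipliable_eulerProd hq (-1))]
  exact tprod_congr fun k => by ring_nf

lemma norm_exp_two_pi_I_lt_one {τ : ℂ} (hτ : 0 < τ.im) : ‖Complex.exp (2 * π * I * τ)‖ < 1 := by
  rw [Complex.norm_exp]
  simp
  positivity

lemma norm_exp_pi_I_lt_one {τ : ℂ} (hτ : 0 < τ.im) : ‖Complex.exp (π * I * τ)‖ < 1 := by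
  rw [Complex.norm_exp]
  simp
  positivity

lemma dedekindEta_eq (τ : ℂ) :
    dedekindEta τ = Complex.exp (π * I * τ / 12) * eulerProd (Complex.exp (2 * π * I * τ)) 1 := by
  unfold dedekindEta eulerProd
  congr 1
  refine tprod_congr fun k => ?_
  rw [mul_one, ← Complex.exp_nat_mul]
  push_cast
  ring_nf

lemma dedekindEta_two_mul (τ : ℂ) :
    dedekindEta (2 * τ) =
      Complex.exp (π * I * τ / 12) ^ 2 * eulerProd (Complex.exp (2 * π * I * τ) ^ 2) 1 := by
  rw [dedekindEta_eq, ← Complex.exp_nat_mul, ← Complex.exp_nat_mul]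
  push_cast
  ring_nf

lemma dedekindEta_ne_zero {τ : ℂ} (hτ : 0 < τ.im) : dedekindEta τ ≠ 0 := by
  rw [dedekindEta_eq]
  exact mul_ne_zero (Complex.exp_ne_zero _) (eulerProd_one_ne_zero (norm_exp_two_pi_I_lt_one hτ))

/-- The theta constant `∑ (-1)^n q^{n²}` with `q = e^{2πiτ}`. -/
def altTheta (τ : ℂ) : ℂ := ∑' n : ℤ, (-1) ^ n * Complex.exp (2 * π * I * n ^ 2 * τ)

/-- Gauss' product formula for `∑ (-1)^n q^{n²}`. -/
lemma altTheta_mul_dedekindEta {τ : ℂ} (hτ : 0 < τ.im) :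
    altTheta τ * dedekindEta (2 * τ) = dedekindEta τ ^ 2 := by
  have hq := norm_exp_two_pi_I_lt_one hτ
  have h := hasSum_jacobi_triple_product hq (Complex.exp_ne_zero _) (neg_ne_zero.mpr one_ne_zero)
  have h1 : altTheta τ = eulerProd (Complex.exp (2 * π * I * τ) ^ 2) 1 *
      (∏' k : ℕ, (1 + Complex.exp (2 * π * I * τ) ^ (2 * k + 1) * (-1))) ^ 2 := by
    rw [altTheta]
    refine (HasSum.congr_fun h fun n => ?_).tsum_eq.trans ?_
    · rw [← Complex.exp_int_mul, mul_comm]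
      congr 2
      push_cast; ring
    · simp only [eulerProd, inv_neg, inv_one, mul_one, sq]
  rw [h1, dedekindEta_two_mul, dedekindEta_eq, eulerProd_one_eq_even_mul_odd hq]
  ring

lemma altTheta_ne_zero {τ : ℂ} (hτ : 0 < τ.im) : altTheta τ ≠ 0 := by
  intro h
  have := altTheta_mul_dedekindEta hτ
  rw [h, zero_mul] at this
  exact pow_ne_zero 2 (dedekindEta_ne_zero hτ) this.symm

lemma jTheta_half {τ : ℂ} (hτ : 0 < τ.im) :
    jTheta (1 / 2) τ * dedekindEta τ = -2 * dedekindEta (2 * τ) ^ 2 := by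
  set p := Complex.exp (π * I * τ) with hp
  have hp1 : ‖p‖ < 1 := norm_exp_pi_I_lt_one hτ
  have hp0 : p ≠ 0 := Complex.exp_ne_zero _
  have hpq : p ^ 2 = Complex.exp (2 * π * I * τ) := by
    rw [hp, ← Complex.exp_nat_mul]; push_cast; ring_nf
  have h := hasSum_jacobi_triple_product hp1 hp0 hp0
  have e1 : (∏' k : ℕ, (1 + p ^ (2 * k + 1) * p)) = eulerProd (p ^ 2) (-1) :=
    tprod_congr fun k => by ring
  have e2 : (∏' k : ℕ, (1 + p ^ (2 * k + 1) * p⁻¹)) = 2 * eulerProd (p ^ 2) (-1) := by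
    have : ∀ k : ℕ, 1 + p ^ (2 * k + 1) * p⁻¹ = 1 + (p ^ 2) ^ k := fun k => by
      rw [pow_succ, mul_assoc, mul_inv_cancel₀ hp0, mul_one, pow_mul]
    rw [tprod_congr this, tprod_eq_zero_mul', eulerProd]
    · congr 1
      · norm_num
      · exact tprod_congr fun k => by ring
    · exact (multipliable_eulerProd (norm_sq_lt_one hp1) (-1)).congr fun k => by ring
  have h1 : jTheta (1 / 2) τ = -Complex.exp (π * I * τ / 12) ^ 3 *
      (eulerProd (p ^ 2) 1 * (eulerProd (p ^ 2) (-1) * (2 * eulerProd (p ^ 2) (-1)))) := by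
    rw [jTheta]
    refine (HasSum.congr_fun (h.mul_left (-Complex.exp (π * I * τ / 12) ^ 3)) fun n => ?_).tsum_eq.trans
      ?_
    · rw [hp, ← Complex.exp_int_mul, ← Complex.exp_int_mul, ← Complex.exp_add,
        ← Complex.exp_nat_mul, neg_mul, ← Complex.exp_add, neg_eq_neg_one_mul, ← Complex.exp_pi_mul_I,
        ← Complex.exp_add, Complex.exp_eq_exp_iff_exists_int]
      exact ⟨n, by push_cast; ring⟩
    · rw [e1, e2]
      simp [eulerProd]
  have h2 := eulerProd_sq_one_eq_mul (norm_sq_lt_one hp1)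
  rw [h1, dedekindEta_two_mul, dedekindEta_eq, ← hpq, h2]
  ring

/-- The product formula for `ϑ(u;2τ)`. -/
lemma jTheta_two_mul_eq_prod {τ : ℂ} (hτ : 0 < τ.im) (u : ℂ) :
    jTheta u (2 * τ) = I * Complex.exp (π * I * τ / 12) ^ 6 * Complex.exp (π * I * u) *
      (eulerProd (Complex.exp (2 * π * I * τ) ^ 2) 1 *
        (eulerProd (Complex.exp (2 * π * I * τ) ^ 2) (Complex.exp (2 * π * I * u)) *
        ((1 - (Complex.exp (2 * π * I * u))⁻¹) *
          eulerProd (Complex.exp (2 * π * I * τ) ^ 2) (Complex.exp (2 * π * I * u))⁻¹))) := by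
  set q := Complex.exp (2 * π * I * τ) with hqd
  set z := Complex.exp (2 * π * I * u) with hzd
  have hq : ‖q‖ < 1 := norm_exp_two_pi_I_lt_one hτ
  have hq0 : q ≠ 0 := Complex.exp_ne_zero _
  have hz0 : z ≠ 0 := Complex.exp_ne_zero _
  have h := hasSum_jacobi_triple_product hq hq0 (neg_ne_zero.mpr (mul_ne_zero hq0 hz0))
  have e1 : (∏' k : ℕ, (1 + q ^ (2 * k + 1) * -(q * z))) = eulerProd (q ^ 2) z :=
    tprod_congr fun k => by ring
  have e2 : (∏' k : ℕ, (1 + q ^ (2 * k + 1) * (-(q * z))⁻¹)) =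
      (1 - z⁻¹) * eulerProd (q ^ 2) z⁻¹ := by
    have : ∀ k : ℕ, 1 + q ^ (2 * k + 1) * (-(q * z))⁻¹ = 1 - (q ^ 2) ^ k * z⁻¹ := fun k => by
      rw [pow_succ, ← pow_mul]
      field_simp
      ring
    rw [tprod_congr this, tprod_eq_zero_mul', eulerProd]
    · simp
    · exact multipliable_eulerProd (norm_sq_lt_one hq) z⁻¹
  rw [jTheta]
  refine (HasSum.congr_fun (h.mul_left (I * Complex.exp (π * I * τ / 12) ^ 6 *
    Complex.exp (π * I * u))) fun n => ?_).tsum_eq.trans ?_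
  · have hI : I = Complex.exp (π / 2 * I) := by rw [Complex.exp_pi_div_two_mul_I]
    have hm : -(q * z) = Complex.exp (π * I + 2 * π * I * τ + 2 * π * I * u) := by
      rw [Complex.exp_add, Complex.exp_add, Complex.exp_pi_mul_I]; ring
    have h3 : I * Complex.exp (π * I * τ / 12) ^ 6 * Complex.exp (π * I * u) =
        Complex.exp (π / 2 * I + π * I * τ / 2 + π * I * u) := by
      rw [Complex.exp_add, Complex.exp_add, ← hI, ← Complex.exp_nat_mul]; push_cast; ring_nf
    rw [hm, h3, hqd, ← Complex.exp_int_mul, ← Complex.exp_int_mul, ← Complex.exp_add,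
        ← Complex.exp_add]
    congr 1
    push_cast
    ring
  · rw [e1, e2]
    simp [eulerProd]

/-- The variable `z q^{2n}` with `z = e^{2πiu}` and `q = e^{2πiτ}`. -/
def appellArg (τ u : ℂ) (n : ℤ) : ℂ := Complex.exp (2 * π * I * (2 * n * τ + u))

lemma appellArg_ne_one {τ u : ℂ} (hu : ∀ m n : ℤ, u ≠ 2 * (m : ℂ) * τ + (n : ℂ)) (m : ℤ) :
    appellArg τ u m ≠ 1 := by
  rw [appellArg, Ne, Complex.exp_eq_one_iff]
  rintro ⟨n, hn⟩
  have hpi : (2 * π * I : ℂ) ≠ 0 := by simp [Real.pi_ne_zero]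
  have : 2 * m * τ + u = n := by
    apply mul_left_cancel₀ hpi
    rw [hn]; ring
  exact hu (-m) n (by rw [← this]; push_cast; ring)

lemma jTheta_two_mul_ne_zero {τ u : ℂ} (hτ : 0 < τ.im)
    (hu : ∀ n : ℤ, appellArg τ u n ≠ 1) : jTheta u (2 * τ) ≠ 0 := by
  rw [jTheta_two_mul_eq_prod hτ]
  simp only [appellArg] at hu
  have hq := norm_sq_lt_one (norm_exp_two_pi_I_lt_one hτ)
  refine mul_ne_zero (mul_ne_zero (mul_ne_zero I_ne_zero (pow_ne_zero _ (Complex.exp_ne_zero _)))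
    (Complex.exp_ne_zero _)) (mul_ne_zero (eulerProd_one_ne_zero hq)
    (mul_ne_zero (eulerProd_ne_zero hq ?_) (mul_ne_zero ?_ (eulerProd_ne_zero hq ?_))))
  · intro k
    have := hu (k + 1)
    rw [← pow_mul, ← Complex.exp_nat_mul, ← Complex.exp_add]
    convert this using 2
    push_cast; ring
  · have := hu 0
    rw [sub_ne_zero]
    intro h
    apply this
    rw [eq_comm, inv_eq_one] at h
    rw [← h]; simp
  · intro k hk
    have := hu (-(k + 1))
    apply this
    rw [← pow_mul, ← Complex.exp_nat_mul, ← Complex.exp_neg, ← Complex.exp_add] at hk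
    rw [← inv_eq_one, ← Complex.exp_neg, ← hk]
    congr 1
    push_cast; ring

/-- The derivative of `ϑ` at the origin (Jacobi). -/
lemma tendsto_jTheta_two_mul_div {τ : ℂ} (hτ : 0 < τ.im) :
    Tendsto (fun u => jTheta u (2 * τ) / u) (𝓝[≠] 0) (𝓝 (-2 * π * dedekindEta (2 * τ) ^ 3)) := by
  set q := Complex.exp (2 * π * I * τ) with hqd
  have hq : ‖q ^ 2‖ < 1 := norm_sq_lt_one (norm_exp_two_pi_I_lt_one hτ)
  have hc := continuous_eulerProd hq
  have hd : HasDerivAt (fun u : ℂ => 1 - (Complex.exp (2 * π * I * u))⁻¹) (2 * π * I) 0 := by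
    have : HasDerivAt (fun u : ℂ => 1 - Complex.exp (-(2 * π * I * u))) (2 * π * I) 0 := by
      have h := ((((hasDerivAt_id (0 : ℂ)).const_mul (2 * π * I)).neg).cexp).const_sub 1
      simpa using h
    simpa only [Complex.exp_neg] using this
  have hs := hd.tendsto_slope
  have hg : ContinuousAt (fun u : ℂ => I * Complex.exp (π * I * τ / 12) ^ 6 * Complex.exp (π * I * u) *
      (eulerProd (q ^ 2) 1 * (eulerProd (q ^ 2) (Complex.exp (2 * π * I * u)) *
          eulerProd (q ^ 2) (Complex.exp (2 * π * I * u))⁻¹))) 0 := by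
    simp only [← Complex.exp_neg]
    fun_prop
  have := (hg.tendsto.mono_left (nhdsWithin_le_nhds (s := {0}ᶜ))).mul hs
  refine (this.congr fun u => ?_).trans (le_of_eq ?_)
  · rw [jTheta_two_mul_eq_prod hτ, slope_def_field]
    simp
    ring
  · congr 1
    rw [dedekindEta_two_mul]
    simp only [mul_zero, Complex.exp_zero, inv_one, mul_one, ← hqd]
    linear_combination (2 * π * Complex.exp (π * I * τ / 12) ^ 6 * eulerProd (q ^ 2) 1 ^ 3) * I_sq

lemma jTheta_eq_jacobiTheta₂ (u τ : ℂ) : jTheta u τ =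
    Complex.exp (π * I * τ / 4 + π * I * (u + 1 / 2)) * jacobiTheta₂ (u + 1 / 2 + τ / 2) τ := by
  rw [jTheta, jacobiTheta₂, ← tsum_mul_left]
  refine tsum_congr fun n => ?_
  rw [jacobiTheta₂_term, ← Complex.exp_add]
  ring_nf

lemma differentiable_jTheta {τ : ℂ} (hτ : 0 < τ.im) : Differentiable ℂ fun u => jTheta u τ := by
  simp only [jTheta_eq_jacobiTheta₂]
  intro u
  have := (differentiableAt_jacobiTheta₂_fst (u + 1 / 2 + τ / 2) hτ).comp u
    (f := fun u => u + 1 / 2 + τ / 2) (by fun_prop)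
  exact DifferentiableAt.mul (by fun_prop) this

lemma jTheta_add_one (u τ : ℂ) : jTheta (u + 1) τ = -jTheta u τ := by
  rw [jTheta_eq_jacobiTheta₂, jTheta_eq_jacobiTheta₂,
    show u + 1 + 1 / 2 + τ / 2 = (u + 1 / 2 + τ / 2) + 1 by ring, jacobiTheta₂_add_left,
    show π * I * τ / 4 + π * I * (u + 1 + 1 / 2) = (π * I * τ / 4 + π * I * (u + 1 / 2)) + π * I by ring,
    Complex.exp_add_pi_mul_I, neg_mul]

lemma jTheta_add_period (u τ : ℂ) :
    jTheta (u + τ) τ = -(Complex.exp (-(π * I * τ) - 2 * π * I * u) * jTheta u τ) := by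
  rw [jTheta_eq_jacobiTheta₂, jTheta_eq_jacobiTheta₂,
    show u + τ + 1 / 2 + τ / 2 = (u + 1 / 2 + τ / 2) + τ by ring, jacobiTheta₂_add_left',
    ← mul_assoc, ← mul_assoc, ← Complex.exp_add, ← Complex.exp_add, ← neg_mul]
  congr 1
  rw [← Complex.exp_sub_pi_mul_I]
  ring_nf

lemma jTheta_neg (u τ : ℂ) : jTheta (-u) τ = -jTheta u τ := by
  have h := jacobiTheta₂_add_left' (u - 1 / 2 - τ / 2) τ
  rw [← jacobiTheta₂_neg_left (u - 1 / 2 - τ / 2), ← jacobiTheta₂_add_left (_ + τ)] at h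
  rw [jTheta_eq_jacobiTheta₂, jTheta_eq_jacobiTheta₂,
    show u + 1 / 2 + τ / 2 = u - 1 / 2 - τ / 2 + τ + 1 by ring, h,
    ← mul_assoc, ← Complex.exp_add, ← neg_mul,
    show -(u - 1 / 2 - τ / 2) = -u + 1 / 2 + τ / 2 by ring]
  congr 1
  rw [← Complex.exp_sub_pi_mul_I, Complex.exp_eq_exp_iff_exists_int]
  exact ⟨0, by push_cast; ring⟩

/-- The coefficient `(-1)^n q^{n²}` with `q = e^{2πiτ}`. -/
def thetaCoeff (τ : ℂ) (n : ℤ) : ℂ := (-1) ^ n * Complex.exp (2 * π * I * n ^ 2 * τ)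

/-- The rational function `x / (1 - x)`. -/
def geomFrac (x : ℂ) : ℂ := x / (1 - x)

lemma norm_thetaCoeff (τ : ℂ) (n : ℤ) :
    ‖thetaCoeff τ n‖ = Real.exp (-π * (2 * τ.im * n ^ 2)) := by
  rw [thetaCoeff, norm_mul, norm_zpow, norm_neg, norm_one, one_zpow, one_mul, Complex.norm_exp]
  congr 1
  have : 2 * π * I * n ^ 2 * τ = ((2 * π * n ^ 2 : ℝ) : ℂ) * (I * τ) := by push_cast; ring
  rw [this, Complex.re_ofReal_mul]
  simp
  ring

lemma norm_appellArg (τ u : ℂ) (n : ℤ) :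
    ‖appellArg τ u n‖ = Real.exp (-2 * π * (2 * n * τ.im + u.im)) := by
  rw [appellArg, Complex.norm_exp]
  congr 1
  have : 2 * π * I * (2 * n * τ + u) = ((2 * π : ℝ) : ℂ) * (I * (((2 * n : ℝ) : ℂ) * τ + u)) := by
    push_cast; ring
  rw [this, Complex.re_ofReal_mul]
  simp
  ring

lemma norm_geomFrac_le_of_norm_le_half {x : ℂ} (hx : ‖x‖ ≤ 1 / 2) : ‖geomFrac x‖ ≤ 2 := by
  have h1 : 1 - ‖x‖ ≤ ‖1 - x‖ := by simpa using norm_sub_norm_le 1 x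
  rw [geomFrac, norm_div, div_le_iff₀ (by linarith)]
  linarith

lemma norm_geomFrac_le_of_two_le_norm {x : ℂ} (hx : 2 ≤ ‖x‖) : ‖geomFrac x‖ ≤ 2 := by
  have h1 : ‖x‖ - 1 ≤ ‖1 - x‖ := by simpa [norm_sub_rev] using norm_sub_norm_le x 1
  rw [geomFrac, norm_div, div_le_iff₀ (by linarith)]
  linarith

/-- The values `geomFrac (z q^{2n})` are bounded uniformly in `n`, locally uniformly in `(u, τ)`,
as long as the indices `n` with `z q^{2n} = 1` are left out. -/
lemma eventually_norm_geomFrac_appellArg_le (s : Set ℤ) {u τ : ℂ} (hτ : 0 < τ.im)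
    (hs : ∀ n ∈ s, appellArg τ u n ≠ 1) :
    ∃ C, ∀ᶠ p : ℂ × ℂ in 𝓝 (u, τ), ∀ n ∈ s,
      appellArg p.2 p.1 n ≠ 1 ∧ ‖geomFrac (appellArg p.2 p.1 n)‖ ≤ C := by
  obtain ⟨N, hN⟩ := exists_nat_gt ((|u.im| + 2) / τ.im)
  rw [div_lt_iff₀ hτ] at hN
  have e1 : ∀ᶠ p : ℂ × ℂ in 𝓝 (u, τ), τ.im / 2 < p.2.im :=
    (continuous_im.comp continuous_snd).continuousAt.eventually_const_lt (by simp; linarith)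
  have e2 : ∀ᶠ p : ℂ × ℂ in 𝓝 (u, τ), |p.1.im| < |u.im| + 1 :=
    (continuous_abs.comp (continuous_im.comp continuous_fst)).continuousAt.eventually_lt_const
      (by simp)
  have hcont : ∀ n : ℤ, Continuous fun p : ℂ × ℂ => appellArg p.2 p.1 n := fun n => by
    unfold appellArg; fun_prop
  set K : ℤ → ℝ := fun n => ‖geomFrac (appellArg τ u n)‖ + 1 with hK
  have e3 : ∀ᶠ p : ℂ × ℂ in 𝓝 (u, τ), ∀ n ∈ Finset.Icc (-N : ℤ) N, n ∈ s →
      appellArg p.2 p.1 n ≠ 1 ∧ ‖geomFrac (appellArg p.2 p.1 n)‖ ≤ K n := by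
    rw [Filter.eventually_all_finset]
    intro n _
    by_cases hn : n ∈ s
    · have h1 := (hcont n).continuousAt.eventually_ne (hs n hn) (x := (u, τ))
      have h2 : ContinuousAt (fun p : ℂ × ℂ => ‖geomFrac (appellArg p.2 p.1 n)‖) (u, τ) := by
        unfold geomFrac
        exact ((hcont n).continuousAt.div (continuousAt_const.sub (hcont n).continuousAt)
          (sub_ne_zero.mpr (hs n hn).symm)).norm
      have h3 := h2.eventually_lt_const (lt_add_one _)
      filter_upwards [h1, h3] with p hp1 hp2 _
      exact ⟨hp1, hp2.le⟩
    · exact Eventually.of_forall fun p h => absurd h hn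
  refine ⟨max 2 (∑ n ∈ Finset.Icc (-N : ℤ) N, K n), ?_⟩
  filter_upwards [e1, e2, e3] with p h1 h2 h3 n hn
  have hK0 : ∀ n, 0 ≤ K n := fun n => by positivity
  have hpi := Real.pi_gt_three
  rw [abs_lt] at h2
  have hexp : Real.exp (-1) ≤ 1 / 2 := by
    have := Real.exp_one_gt_d9
    rw [Real.exp_neg, inv_le_comm₀ (Real.exp_pos _) (by norm_num)]
    linarith
  have hexp' : 2 ≤ Real.exp 1 := by
    have := Real.exp_one_gt_d9
    linarith
  by_cases hmem : n ∈ Finset.Icc (-N : ℤ) N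
  · obtain ⟨h4, h5⟩ := h3 n hmem hn
    exact ⟨h4, h5.trans ((Finset.single_le_sum (fun i _ => hK0 i) hmem).trans (le_max_right _ _))⟩
  · rw [Finset.mem_Icc, not_and_or, not_le, not_le] at hmem
    rcases hmem with h | h
    · have hnR : (n : ℝ) < -N := by exact_mod_cast h
      have hx : 2 ≤ ‖appellArg p.2 p.1 n‖ := by
        rw [norm_appellArg]
        refine hexp'.trans (Real.exp_le_exp.mpr ?_)
        have : 2 * n * p.2.im + p.1.im ≤ -1 := by nlinarith
        nlinarith
      refine ⟨fun h => ?_, (norm_geomFrac_le_of_two_le_norm hx).trans (le_max_left _ _)⟩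
      rw [h, norm_one] at hx
      linarith
    · have hnR : (N : ℝ) < n := by exact_mod_cast h
      have hx : ‖appellArg p.2 p.1 n‖ ≤ 1 / 2 := by
        rw [norm_appellArg]
        refine (Real.exp_le_exp.mpr ?_).trans hexp
        have : 1 ≤ 2 * n * p.2.im + p.1.im := by nlinarith
        nlinarith
      refine ⟨fun h => ?_, (norm_geomFrac_le_of_norm_le_half hx).trans (le_max_left _ _)⟩
      rw [h, norm_one] at hx
      linarith

lemma summable_abs_pow_mul_gaussian {T : ℝ} (hT : 0 < T) (k : ℕ) :
    Summable fun n : ℤ => |(n : ℝ)| ^ k * Real.exp (-π * (2 * T * n ^ 2)) := by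
  refine (summable_pow_mul_jacobiTheta₂_term_bound 0 (T := 2 * T) (by positivity) k).congr fun n => ?_
  simp

lemma exists_norm_le_of_continuous {P : ℂ → ℂ} (hP : Continuous P) (C : ℝ) :
    ∃ D, 0 ≤ D ∧ ∀ x, ‖x‖ ≤ C → ‖P x‖ ≤ D := by
  obtain ⟨D, hD⟩ := (isCompact_closedBall (0 : ℂ) C).exists_bound_of_continuousOn hP.continuousOn
  exact ⟨max D 0, le_max_right _ _, fun x hx => (hD x (by simpa using hx)).trans (le_max_left _ _)⟩

lemma norm_thetaCoeff_mul_le {T : ℝ} {τ : ℂ} (h : T ≤ τ.im) (n : ℤ) (k : ℕ) {w : ℂ} {D : ℝ}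
    (hw : ‖w‖ ≤ D) : ‖thetaCoeff τ n * (n ^ k * w)‖ ≤
      |(n : ℝ)| ^ k * Real.exp (-π * (2 * T * n ^ 2)) * D := by
  rw [norm_mul, norm_mul, norm_pow, norm_thetaCoeff, Complex.norm_intCast]
  have : Real.exp (-π * (2 * τ.im * n ^ 2)) ≤ Real.exp (-π * (2 * T * n ^ 2)) := by
    apply Real.exp_le_exp.mpr
    have : 0 ≤ π * (n : ℝ) ^ 2 := by positivity
    nlinarith
  calc _ = |(n : ℝ)| ^ k * Real.exp (-π * (2 * τ.im * n ^ 2)) * ‖w‖ := by ring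
    _ ≤ _ := by gcongr

/-- The sums `∑ (-1)^n n^k q^{n²} P(z q^{2n} / (1 - z q^{2n}))`. -/
def appellSum (k : ℕ) (P : ℂ → ℂ) (τ u : ℂ) : ℂ :=
  ∑' n : ℤ, thetaCoeff τ n * (n ^ k * P (geomFrac (appellArg τ u n)))

lemma summable_appellSum (k : ℕ) {P : ℂ → ℂ} (hP : Continuous P) {τ u : ℂ} (hτ : 0 < τ.im)
    (hu : ∀ n, appellArg τ u n ≠ 1) :
    Summable fun n : ℤ => thetaCoeff τ n * (n ^ k * P (geomFrac (appellArg τ u n))) := by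
  obtain ⟨C, hC⟩ := eventually_norm_geomFrac_appellArg_le Set.univ hτ fun n _ => hu n
  obtain ⟨D, -, hD⟩ := exists_norm_le_of_continuous hP C
  exact ((summable_abs_pow_mul_gaussian hτ k).mul_right D).of_norm_bounded fun n =>
    norm_thetaCoeff_mul_le le_rfl n k (hD _ (hC.self_of_nhds n trivial).2)

lemma hasDerivAt_geomFrac {x : ℂ} (hx : x ≠ 1) :
    HasDerivAt geomFrac (1 / (1 - x) ^ 2) x := by
  have h := (hasDerivAt_id x).div ((hasDerivAt_id x).const_sub 1) (sub_ne_zero.mpr hx.symm)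
  refine h.congr_deriv ?_
  simp

lemma mul_inv_one_sub_sq {x : ℂ} (hx : x ≠ 1) :
    x / (1 - x) ^ 2 = geomFrac x * (1 + geomFrac x) := by
  have := sub_ne_zero.mpr hx.symm
  rw [geomFrac]
  field_simp
  ring

lemma hasDerivAt_geomFrac_appellArg_snd {τ u : ℂ} {n : ℤ} (hx : appellArg τ u n ≠ 1) :
    HasDerivAt (fun w => geomFrac (appellArg τ w n)) (2 * π * I *
      (geomFrac (appellArg τ u n) * (1 + geomFrac (appellArg τ u n)))) u := by
  have h1 : HasDerivAt (fun w => appellArg τ w n) (appellArg τ u n * (2 * π * I)) u := by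
    unfold appellArg
    have := (((hasDerivAt_id u).const_add (2 * n * τ)).const_mul (2 * π * I)).cexp
    simpa using this
  refine ((hasDerivAt_geomFrac hx).comp u h1).congr_deriv ?_
  rw [← mul_inv_one_sub_sq hx]
  ring

lemma hasDerivAt_geomFrac_appellArg_fst {τ u : ℂ} {n : ℤ} (hx : appellArg τ u n ≠ 1) :
    HasDerivAt (fun t => geomFrac (appellArg t u n)) (2 * π * I * (2 * n *
      (geomFrac (appellArg τ u n) * (1 + geomFrac (appellArg τ u n))))) τ := by
  have h1 : HasDerivAt (fun t => appellArg t u n) (appellArg τ u n * (2 * π * I * (2 * n))) τ := by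
    unfold appellArg
    have := ((((hasDerivAt_id τ).const_mul (2 * n : ℂ)).add_const u).const_mul (2 * π * I)).cexp
    simpa using this
  refine ((hasDerivAt_geomFrac hx).comp τ h1).congr_deriv ?_
  rw [← mul_inv_one_sub_sq hx]
  ring

lemma hasDerivAt_thetaCoeff (τ : ℂ) (n : ℤ) :
    HasDerivAt (fun t => thetaCoeff t n) (2 * π * I * n ^ 2 * thetaCoeff τ n) τ := by
  unfold thetaCoeff
  have := ((((hasDerivAt_id τ).const_mul (2 * π * I * n ^ 2 : ℂ))).cexp).const_mul ((-1 : ℂ) ^ n)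
  refine this.congr_deriv ?_
  simp
  ring

lemma eventually_appellArg_ne_one {τ u : ℂ} (hτ : 0 < τ.im) (hu : ∀ n, appellArg τ u n ≠ 1) :
    ∀ᶠ w in 𝓝 u, ∀ n, appellArg τ w n ≠ 1 := by
  obtain ⟨C, hC⟩ := eventually_norm_geomFrac_appellArg_le Set.univ hτ fun n _ => hu n
  filter_upwards [hC.curry_nhds] with w hw n
  exact (hw.self_of_nhds n trivial).1

lemma hasDerivAt_appellSum_snd (k : ℕ) {P : ℂ → ℂ} (hP : Differentiable ℂ P) {τ u : ℂ}
    (hτ : 0 < τ.im) (hu : ∀ n, appellArg τ u n ≠ 1) :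
    HasDerivAt (fun w => appellSum k P τ w)
      (2 * π * I * appellSum k (fun x => deriv P x * (x * (1 + x))) τ u) u := by
  obtain ⟨C, hC⟩ := eventually_norm_geomFrac_appellArg_le Set.univ hτ fun n _ => hu n
  obtain ⟨D, hD0, hD⟩ := exists_norm_le_of_continuous hP.continuous C
  have hC' : ∀ᶠ w in 𝓝 u, ∀ n, appellArg τ w n ≠ 1 ∧ ‖geomFrac (appellArg τ w n)‖ ≤ C := by
    filter_upwards [hC.curry_nhds] with w hw n
    exact hw.self_of_nhds n trivial
  obtain ⟨U, hU, hUo, huU⟩ := eventually_nhds_iff.mp hC'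
  have hd : ∀ w ∈ U, ∀ n : ℤ, HasDerivAt
      (fun w => thetaCoeff τ n * (n ^ k * P (geomFrac (appellArg τ w n))))
      (2 * π * I * (thetaCoeff τ n * (n ^ k * (deriv P (geomFrac (appellArg τ w n)) *
        (geomFrac (appellArg τ w n) * (1 + geomFrac (appellArg τ w n))))))) w := by
    intro w hw n
    have h1 := (hP (geomFrac (appellArg τ w n))).hasDerivAt.comp w
      (hasDerivAt_geomFrac_appellArg_snd (hU w hw n).1)
    exact ((h1.const_mul ((n : ℂ) ^ k)).const_mul (thetaCoeff τ n)).congr_deriv (by ring)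
  have hsum := (summable_abs_pow_mul_gaussian hτ k).mul_right D
  have hb : ∀ (n : ℤ) (w : ℂ), w ∈ U →
      ‖thetaCoeff τ n * (n ^ k * P (geomFrac (appellArg τ w n)))‖ ≤
        |(n : ℝ)| ^ k * Real.exp (-π * (2 * τ.im * n ^ 2)) * D := fun n w hw =>
    norm_thetaCoeff_mul_le le_rfl n k (hD _ (hU w hw n).2)
  have hdiff : ∀ n : ℤ, DifferentiableOn ℂ
      (fun w => thetaCoeff τ n * (n ^ k * P (geomFrac (appellArg τ w n)))) U := fun n w hw =>
    (hd w hw n).differentiableAt.differentiableWithinAt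
  have h1 := (Complex.differentiableOn_tsum_of_summable_norm hsum hdiff hUo hb).differentiableAt
    (hUo.mem_nhds huU)
  have h2 := Complex.hasSum_deriv_of_summable_norm hsum hdiff hUo hb huU
  refine h1.hasDerivAt.congr_deriv ?_
  rw [← h2.tsum_eq, appellSum, ← tsum_mul_left]
  exact tsum_congr fun n => (hd u huU n).deriv

lemma hasDerivAt_appellSum_fst {P : ℂ → ℂ} (hP : Differentiable ℂ P) {τ u : ℂ}
    (hτ : 0 < τ.im) (hu : ∀ n, appellArg τ u n ≠ 1) :
    HasDerivAt (fun t => appellSum 0 P t u)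
      (2 * π * I * (appellSum 2 P τ u +
        2 * appellSum 1 (fun x => deriv P x * (x * (1 + x))) τ u)) τ := by
  obtain ⟨C, hC⟩ := eventually_norm_geomFrac_appellArg_le Set.univ hτ fun n _ => hu n
  obtain ⟨D, hD0, hD⟩ := exists_norm_le_of_continuous hP.continuous C
  have hC' : ∀ᶠ t in 𝓝 τ, ∀ n, appellArg t u n ≠ 1 ∧ ‖geomFrac (appellArg t u n)‖ ≤ C := by
    filter_upwards [hC.curry_nhds.self_of_nhds] with t ht n
    exact ht n trivial
  have him : ∀ᶠ t : ℂ in 𝓝 τ, τ.im / 2 < t.im :=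
    continuous_im.continuousAt.eventually_const_lt (by linarith)
  obtain ⟨U, hU, hUo, huU⟩ := eventually_nhds_iff.mp (hC'.and him)
  have hd : ∀ t ∈ U, ∀ n : ℤ, HasDerivAt
      (fun t => thetaCoeff t n * (n ^ 0 * P (geomFrac (appellArg t u n))))
      (2 * π * I * (thetaCoeff t n * (n ^ 2 * P (geomFrac (appellArg t u n))) +
        2 * (thetaCoeff t n * (n ^ 1 * (deriv P (geomFrac (appellArg t u n)) *
        (geomFrac (appellArg t u n) * (1 + geomFrac (appellArg t u n)))))))) t := by
    intro t ht n
    have h1 := (hP (geomFrac (appellArg t u n))).hasDerivAt.comp t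
      (hasDerivAt_geomFrac_appellArg_fst ((hU t ht).1 n).1)
    refine ((hasDerivAt_thetaCoeff t n).mul (h1.const_mul ((n : ℂ) ^ 0))).congr_deriv ?_
    simp only [Function.comp_apply]
    ring
  have hsum := (summable_abs_pow_mul_gaussian (half_pos hτ) 0).mul_right D
  have hb : ∀ (n : ℤ) (t : ℂ), t ∈ U →
      ‖thetaCoeff t n * (n ^ 0 * P (geomFrac (appellArg t u n)))‖ ≤
        |(n : ℝ)| ^ 0 * Real.exp (-π * (2 * (τ.im / 2) * n ^ 2)) * D := fun n t ht =>
    norm_thetaCoeff_mul_le (hU t ht).2.le n 0 (hD _ ((hU t ht).1 n).2)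
  have hdiff : ∀ n : ℤ, DifferentiableOn ℂ
      (fun t => thetaCoeff t n * (n ^ 0 * P (geomFrac (appellArg t u n)))) U := fun n t ht =>
    (hd t ht n).differentiableAt.differentiableWithinAt
  have h1 := (Complex.differentiableOn_tsum_of_summable_norm hsum hdiff hUo hb).differentiableAt
    (hUo.mem_nhds huU)
  have h2 := Complex.hasSum_deriv_of_summable_norm hsum hdiff hUo hb huU
  refine h1.hasDerivAt.congr_deriv ?_
  have hP' : Continuous fun x => deriv P x * (x * (1 + x)) :=
    hP.contDiff.continuous_deriv (n := 1) le_rfl |>.mul (by fun_prop)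
  rw [← h2.tsum_eq, appellSum, appellSum, ← tsum_mul_left (a := 2),
    ← (summable_appellSum 2 hP.continuous hτ hu).tsum_add
      ((summable_appellSum 1 hP' hτ hu).mul_left 2), ← tsum_mul_left]
  exact tsum_congr fun n => (hd τ huU n).deriv

lemma appellSum_zero_one (τ u : ℂ) : appellSum 0 (fun _ => 1) τ u = altTheta τ := by
  simp [appellSum, altTheta, thetaCoeff]

lemma eventually_nhdsNE_appellArg_ne_one {τ : ℂ} (hτ : 0 < τ.im) (u : ℂ) :
    ∀ᶠ w in 𝓝[≠] u, ∀ n, appellArg τ w n ≠ 1 := by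
  obtain ⟨C, hC⟩ := eventually_norm_geomFrac_appellArg_le {n | appellArg τ u n ≠ 1} hτ
    fun n hn => hn
  have h1 : ∀ᶠ w in 𝓝 u, ∀ n, appellArg τ u n ≠ 1 → appellArg τ w n ≠ 1 := by
    filter_upwards [hC.curry_nhds] with w hw n hn
    exact (hw.self_of_nhds n hn).1
  have h2 : ∀ᶠ w in 𝓝 u, ‖w - u‖ < 1 :=
    ((continuous_id.sub continuous_const).norm).continuousAt.eventually_lt_const (by simp)
  filter_upwards [h1.filter_mono nhdsWithin_le_nhds, h2.filter_mono nhdsWithin_le_nhds,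
    self_mem_nhdsWithin] with w hw1 hw2 hw3 n
  by_cases hn : appellArg τ u n = 1
  · intro hw
    have h4 : appellArg τ w n = appellArg τ u n * Complex.exp (2 * π * I * (w - u)) := by
      rw [appellArg, appellArg, ← Complex.exp_add]
      congr 1
      ring
    rw [hw, hn, one_mul] at h4
    obtain ⟨m, hm⟩ := Complex.exp_eq_one_iff.mp h4.symm
    have h5 : w - u = m := by
      refine mul_left_cancel₀ Complex.two_pi_I_ne_zero (hm.trans (by ring))
    have hm0 : m ≠ 0 := by
      rintro rfl
      exact hw3 (sub_eq_zero.mp (by simpa using h5))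
    rw [h5, Complex.norm_intCast] at hw2
    exact absurd (Int.one_le_abs hm0) (not_le.mpr (by exact_mod_cast hw2))
  · exact hw1 n hn

/-- Near a zero of `1 - z`, an Appell sum is its `n = 0` term up to a bounded error. -/
lemma tendsto_pow_mul_appellSum_sub (k : ℕ) {P : ℂ → ℂ} (hP : Continuous P) {τ : ℂ}
    (hτ : 0 < τ.im) :
    Tendsto (fun u => u ^ 3 * (appellSum k P τ u - 0 ^ k * P (geomFrac (appellArg τ u 0))))
      (𝓝[≠] 0) (𝓝 0) := by
  obtain ⟨C, hC⟩ := eventually_norm_geomFrac_appellArg_le (u := 0) {0}ᶜ hτ fun n hn h => by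
    have h1 := norm_appellArg τ 0 n
    rw [h, norm_one, eq_comm, Real.exp_eq_one_iff] at h1
    have h2 := Real.pi_pos.ne'
    simp [h2, hτ.ne'] at h1
    exact hn h1
  obtain ⟨D, hD0, hD⟩ := exists_norm_le_of_continuous hP C
  set S : ℝ := ∑' n : ℤ, |(n : ℝ)| ^ k * Real.exp (-π * (2 * τ.im * n ^ 2)) * D
  have hS := (summable_abs_pow_mul_gaussian hτ k).mul_right D
  have hb : ∀ᶠ u in 𝓝[≠] 0,
      ‖appellSum k P τ u - 0 ^ k * P (geomFrac (appellArg τ u 0))‖ ≤ S := by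
    have h1 : ∀ᶠ u in 𝓝 0, ∀ n ∈ ({0}ᶜ : Set ℤ), ‖geomFrac (appellArg τ u n)‖ ≤ C := by
      filter_upwards [hC.curry_nhds] with w hw n hn
      exact (hw.self_of_nhds n hn).2
    filter_upwards [h1.filter_mono nhdsWithin_le_nhds, eventually_nhdsNE_appellArg_ne_one hτ 0]
      with u hu1 hu2
    rw [appellSum, (summable_appellSum k hP hτ hu2).tsum_eq_add_tsum_ite 0]
    have h0 : thetaCoeff τ 0 = 1 := by simp [thetaCoeff]
    rw [h0, Int.cast_zero, one_mul, add_sub_cancel_left]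
    refine tsum_of_norm_bounded hS.hasSum fun n => ?_
    split_ifs with hn
    · rw [norm_zero]
      positivity
    · exact norm_thetaCoeff_mul_le le_rfl n k (hD _ (hu1 n hn))
  have h3 : Tendsto (fun u : ℂ => u ^ 3) (𝓝[≠] 0) (𝓝 0) :=
    ((continuous_pow 3).tendsto' 0 0 (by simp)).mono_left nhdsWithin_le_nhds
  exact h3.zero_mul_isBoundedUnder_le ⟨S, by simpa using hb⟩

/-- The derivative of `altTheta`, up to the factor `2πi`. -/
def altThetaDeriv (τ : ℂ) : ℂ := ∑' n : ℤ, thetaCoeff τ n * n ^ 2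

/-- The Appell sum `∑ (-1)^n q^{n²} z q^{2n} / (1 - z q^{2n})`. -/
def appell (τ u : ℂ) : ℂ := appellSum 0 id τ u

/-- The image of `appell` under the heat operator, up to a constant factor. -/
def appellHeat (τ u : ℂ) : ℂ :=
  appellSum 2 id τ u + 2 * appellSum 1 (fun x => x * (1 + x)) τ u +
    appellSum 0 (fun x => (1 + 2 * x) * (x * (1 + x))) τ u

/-- The image of `appell / altTheta` under the heat operator, up to a constant factor. -/
def appellHeatQuot (τ u : ℂ) : ℂ :=
  appellHeat τ u / altTheta τ - appell τ u * altThetaDeriv τ / altTheta τ ^ 2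

lemma hasSum_altTheta {τ : ℂ} (hτ : 0 < τ.im) : HasSum (thetaCoeff τ) (altTheta τ) := by
  have h := (summable_abs_pow_mul_gaussian hτ 0).mul_right 1
  refine (h.of_norm_bounded fun n => ?_).hasSum
  simpa using norm_thetaCoeff_mul_le le_rfl n 0 (w := 1) norm_one.le

lemma hasSum_altThetaDeriv {τ : ℂ} (hτ : 0 < τ.im) :
    HasSum (fun n : ℤ => thetaCoeff τ n * n ^ 2) (altThetaDeriv τ) := by
  have h := (summable_abs_pow_mul_gaussian hτ 2).mul_right 1
  refine (h.of_norm_bounded fun n => ?_).hasSum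
  simpa using norm_thetaCoeff_mul_le le_rfl n 2 (w := 1) norm_one.le

lemma hasSum_appell {τ u : ℂ} (hτ : 0 < τ.im) (hu : ∀ n, appellArg τ u n ≠ 1) :
    HasSum (fun n : ℤ => thetaCoeff τ n * geomFrac (appellArg τ u n)) (appell τ u) := by
  simpa [appell, appellSum] using (summable_appellSum 0 continuous_id hτ hu).hasSum

lemma hasSum_appellHeat {τ u : ℂ} (hτ : 0 < τ.im) (hu : ∀ n, appellArg τ u n ≠ 1) :
    HasSum (fun n : ℤ => thetaCoeff τ n * (geomFrac (appellArg τ u n) *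
      (n ^ 2 + 2 * n * (1 + geomFrac (appellArg τ u n)) +
        (1 + 2 * geomFrac (appellArg τ u n)) * (1 + geomFrac (appellArg τ u n)))))
      (appellHeat τ u) := by
  have h2 := (summable_appellSum 2 continuous_id hτ hu).hasSum
  have h1 := (summable_appellSum 1 (P := fun x => x * (1 + x)) (by fun_prop) hτ hu).hasSum
  have h0 := (summable_appellSum 0 (P := fun x => (1 + 2 * x) * (x * (1 + x)))
    (by fun_prop) hτ hu).hasSum
  refine ((h2.add (h1.mul_left 2)).add h0).congr_fun fun n => ?_
  simp only [id]
  ring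

lemma appellArg_add_period (τ u : ℂ) (n : ℤ) :
    appellArg τ (u + 2 * τ) n = appellArg τ u (n + 1) := by
  rw [appellArg, appellArg]
  congr 1
  push_cast
  ring

lemma appellArg_add_one (τ u : ℂ) (n : ℤ) : appellArg τ (u + 1) n = appellArg τ u n := by
  rw [appellArg, appellArg, Complex.exp_eq_exp_iff_exists_int]
  exact ⟨1, by push_cast; ring⟩

lemma appellArg_neg (τ u : ℂ) (n : ℤ) : appellArg τ (-u) n = (appellArg τ u (-n))⁻¹ := by
  rw [appellArg, appellArg, ← Complex.exp_neg]
  congr 1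
  push_cast
  ring

lemma geomFrac_inv {x : ℂ} (hx : x ≠ 1) (hx0 : x ≠ 0) : geomFrac x⁻¹ = -(1 + geomFrac x) := by
  have h1 := sub_ne_zero.mpr hx.symm
  have h2 := sub_ne_zero.mpr hx
  rw [geomFrac, geomFrac]
  have h3 : 1 - x⁻¹ = (x - 1) / x := by field_simp
  rw [h3]
  field_simp
  ring

lemma thetaCoeff_neg (τ : ℂ) (n : ℤ) : thetaCoeff τ (-n) = thetaCoeff τ n := by
  rw [thetaCoeff, thetaCoeff, zpow_neg, ← inv_zpow]
  norm_num

lemma thetaCoeff_mul_geomFrac {τ u : ℂ} {n : ℤ} (hu : appellArg τ u (n + 1) ≠ 1) :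
    thetaCoeff τ n * geomFrac (appellArg τ u (n + 1)) =
      -(Complex.exp (2 * π * I * (τ + u)) *
        (thetaCoeff τ (n + 1) * (1 + geomFrac (appellArg τ u (n + 1))))) := by
  have h1 : thetaCoeff τ n * appellArg τ u (n + 1) =
      -(Complex.exp (2 * π * I * (τ + u)) * thetaCoeff τ (n + 1)) := by
    rw [thetaCoeff, thetaCoeff, appellArg, zpow_add_one₀ (by norm_num), mul_assoc,
      ← Complex.exp_add]
    have : (2 * π * I * n ^ 2 * τ + 2 * π * I * (2 * ((n + 1 : ℤ) : ℂ) * τ + u) : ℂ) =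
        2 * π * I * (τ + u) + 2 * π * I * ((n + 1 : ℤ) : ℂ) ^ 2 * τ := by
      push_cast
      ring
    rw [this, Complex.exp_add]
    ring
  have h2 := sub_ne_zero.mpr hu.symm
  have h3 : 1 + geomFrac (appellArg τ u (n + 1)) = 1 / (1 - appellArg τ u (n + 1)) := by
    rw [geomFrac]
    field_simp
    ring
  rw [h3, geomFrac]
  field_simp
  linear_combination h1

lemma appell_add_period {τ u : ℂ} (hτ : 0 < τ.im) (hu : ∀ n, appellArg τ u n ≠ 1) :
    appell τ (u + 2 * τ) =
      -(Complex.exp (2 * π * I * (τ + u)) * (appell τ u + altTheta τ)) := by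
  have h1 := hasSum_appell (u := u + 2 * τ) hτ fun n => by rw [appellArg_add_period]; exact hu _
  have h2 := ((Equiv.addRight (1 : ℤ)).hasSum_iff.mpr
    (((hasSum_appell hτ hu).add (hasSum_altTheta hτ)).mul_left
      (-Complex.exp (2 * π * I * (τ + u)))))
  rw [← neg_mul]
  refine h1.unique (h2.congr_fun fun n => ?_)
  simp only [Function.comp_apply, Equiv.coe_addRight, appellArg_add_period]
  linear_combination thetaCoeff_mul_geomFrac (hu (n + 1))

lemma appellHeat_add_period {τ u : ℂ} (hτ : 0 < τ.im) (hu : ∀ n, appellArg τ u n ≠ 1) :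
    appellHeat τ (u + 2 * τ) =
      -(Complex.exp (2 * π * I * (τ + u)) * (appellHeat τ u + altThetaDeriv τ)) := by
  have h1 := hasSum_appellHeat (u := u + 2 * τ) hτ fun n => by
    rw [appellArg_add_period]; exact hu _
  have h2 := ((Equiv.addRight (1 : ℤ)).hasSum_iff.mpr
    (((hasSum_appellHeat hτ hu).add (hasSum_altThetaDeriv hτ)).mul_left
      (-Complex.exp (2 * π * I * (τ + u)))))
  rw [← neg_mul]
  refine h1.unique (h2.congr_fun fun n => ?_)
  simp only [Function.comp_apply, Equiv.coe_addRight, appellArg_add_period, Int.cast_add,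
    Int.cast_one]
  linear_combination (n ^ 2 + 2 * n * (1 + geomFrac (appellArg τ u (n + 1))) +
    (1 + 2 * geomFrac (appellArg τ u (n + 1))) * (1 + geomFrac (appellArg τ u (n + 1)))) *
    thetaCoeff_mul_geomFrac (hu (n + 1))

lemma appellArg_neg_ne_one {τ u : ℂ} (hu : ∀ n, appellArg τ u n ≠ 1) (n : ℤ) :
    appellArg τ (-u) n ≠ 1 := by
  rw [appellArg_neg, Ne, inv_eq_one]
  exact hu _

lemma appell_neg {τ u : ℂ} (hτ : 0 < τ.im) (hu : ∀ n, appellArg τ u n ≠ 1) :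
    appell τ (-u) = -(appell τ u + altTheta τ) := by
  have h1 := hasSum_appell hτ (appellArg_neg_ne_one hu)
  have h2 := (Equiv.neg ℤ).hasSum_iff.mpr
    (((hasSum_appell hτ hu).add (hasSum_altTheta hτ)).neg)
  refine h1.unique (h2.congr_fun fun n => ?_)
  simp only [Function.comp_apply, Equiv.neg_apply, appellArg_neg, thetaCoeff_neg,
    geomFrac_inv (hu (-n)) (Complex.exp_ne_zero _)]
  ring

lemma appellHeat_neg {τ u : ℂ} (hτ : 0 < τ.im) (hu : ∀ n, appellArg τ u n ≠ 1) :
    appellHeat τ (-u) = -(appellHeat τ u + altThetaDeriv τ) := by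
  have h1 := hasSum_appellHeat hτ (appellArg_neg_ne_one hu)
  have h2 := (Equiv.neg ℤ).hasSum_iff.mpr
    (((hasSum_appellHeat hτ hu).add (hasSum_altThetaDeriv hτ)).neg)
  refine h1.unique (h2.congr_fun fun n => ?_)
  simp only [Function.comp_apply, Equiv.neg_apply, appellArg_neg, thetaCoeff_neg,
    geomFrac_inv (hu (-n)) (Complex.exp_ne_zero _), Int.cast_neg]
  ring

lemma appellHeatQuot_add_period {τ u : ℂ} (hτ : 0 < τ.im) (hu : ∀ n, appellArg τ u n ≠ 1) :
    appellHeatQuot τ (u + 2 * τ) = -(Complex.exp (2 * π * I * (τ + u)) * appellHeatQuot τ u) := by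
  have := altTheta_ne_zero hτ
  rw [appellHeatQuot, appellHeatQuot, appell_add_period hτ hu, appellHeat_add_period hτ hu]
  field_simp
  ring

lemma appellHeatQuot_add_one (τ u : ℂ) : appellHeatQuot τ (u + 1) = appellHeatQuot τ u := by
  simp only [appellHeatQuot, appellHeat, appell, appellSum, appellArg_add_one]

lemma appellHeatQuot_neg {τ u : ℂ} (hτ : 0 < τ.im) (hu : ∀ n, appellArg τ u n ≠ 1) :
    appellHeatQuot τ (-u) = -appellHeatQuot τ u := by
  have := altTheta_ne_zero hτ
  rw [appellHeatQuot, appellHeatQuot, appell_neg hτ hu, appellHeat_neg hτ hu]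
  field_simp
  ring

lemma differentiableAt_appellHeatQuot {τ u : ℂ} (hτ : 0 < τ.im)
    (hu : ∀ n, appellArg τ u n ≠ 1) : DifferentiableAt ℂ (appellHeatQuot τ) u := by
  have h (k : ℕ) {P : ℂ → ℂ} (hP : Differentiable ℂ P) :=
    (hasDerivAt_appellSum_snd k hP hτ hu).differentiableAt
  have h0 := h 0 (P := fun x => (1 + 2 * x) * (x * (1 + x))) (by fun_prop)
  have h1 := h 1 (P := fun x => x * (1 + x)) (by fun_prop)
  have h2 := h 2 differentiable_id
  have h3 := h 0 differentiable_id
  unfold appellHeatQuot appellHeat appell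
  exact (((h2.add (h1.const_mul 2)).add h0).div_const _).sub ((h3.mul_const _).div_const _)

lemma tendsto_mul_geomFrac_appellArg_zero (τ : ℂ) :
    Tendsto (fun u => u * geomFrac (appellArg τ u 0)) (𝓝[≠] 0) (𝓝 (-(2 * π * I)⁻¹)) := by
  have h1 : HasDerivAt (fun u => appellArg τ u 0) (2 * π * I) 0 := by
    have := ((hasDerivAt_id (0 : ℂ)).const_mul (2 * π * I)).cexp
    simpa [appellArg] using this
  have h2 := h1.tendsto_slope_zero
  have h3 : Tendsto (fun u => appellArg τ u 0) (𝓝[≠] 0) (𝓝 1) :=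
    (h1.continuousAt.tendsto.mono_left nhdsWithin_le_nhds).trans (by simp [appellArg])
  have h4 := (h3.mul (h2.inv₀ Complex.two_pi_I_ne_zero)).neg
  rw [one_mul] at h4
  refine h4.congr fun u => ?_
  have h5 : appellArg τ 0 0 = 1 := by simp [appellArg]
  rw [zero_add, h5, geomFrac, smul_eq_mul, mul_inv, inv_inv, ← neg_sub (appellArg τ u 0) 1,
    div_neg, div_eq_mul_inv]
  ring

lemma tendsto_pow_mul_appellHeatQuot {τ : ℂ} (hτ : 0 < τ.im) :
    Tendsto (fun u => u ^ 3 * appellHeatQuot τ u) (𝓝[≠] 0)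
      (𝓝 (2 * (-(2 * π * I)⁻¹) ^ 3 / altTheta τ)) := by
  have hg := tendsto_mul_geomFrac_appellArg_zero τ
  have hid : Tendsto (fun u : ℂ => u) (𝓝[≠] 0) (𝓝 0) := tendsto_id.mono_left nhdsWithin_le_nhds
  have h2 := tendsto_pow_mul_appellSum_sub 2 continuous_id hτ
  have h1 := tendsto_pow_mul_appellSum_sub 1 (P := fun x => x * (1 + x)) (by fun_prop) hτ
  have h0 := tendsto_pow_mul_appellSum_sub 0 (P := fun x => (1 + 2 * x) * (x * (1 + x)))
    (by fun_prop) hτ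
  have h3 := tendsto_pow_mul_appellSum_sub 0 continuous_id hτ
  have key := ((((h2.add (h1.const_mul 2)).add h0).add
    ((hid.add (hg.const_mul 2)).mul (hg.mul (hid.add hg)))).div_const (altTheta τ)).sub
    (((h3.add ((hid.pow 2).mul hg)).mul_const (altThetaDeriv τ)).div_const (altTheta τ ^ 2))
  refine (key.congr fun u => ?_).trans (le_of_eq (congrArg 𝓝 ?_))
  · simp only [appellHeatQuot, appellHeat, appell, id]
    ring
  · ring

lemma tendsto_add_nhdsNE (u p : ℂ) : Tendsto (fun w => w + p) (𝓝[≠] u) (𝓝[≠] (u + p)) := by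
  refine tendsto_nhdsWithin_iff.mpr ⟨?_, ?_⟩
  · exact (continuous_id.add continuous_const).continuousAt.mono_left nhdsWithin_le_nhds
  · filter_upwards [self_mem_nhdsWithin] with w hw h
    exact hw (add_right_cancel h)

/-- An entire function that is periodic in one direction and antiperiodic in an independent
direction vanishes. -/
lemma eq_zero_of_antiperiodic_of_periodic {f : ℂ → ℂ} {ω : ℂ} (hω : 0 < ω.im)
    (hf : Differentiable ℂ f) (h1 : Function.Antiperiodic f 1) (h2 : Function.Periodic f ω)
    (u : ℂ) : f u = 0 := by
  have hK : IsCompact ((fun p : ℝ × ℝ => (p.1 : ℂ) + p.2 * ω) '' (Set.Icc 0 1 ×ˢ Set.Icc 0 1)) :=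
    (isCompact_Icc.prod isCompact_Icc).image (by fun_prop)
  obtain ⟨C, hC⟩ := hK.exists_bound_of_continuousOn hf.continuous.continuousOn
  have hn1 : Function.Periodic (fun w => ‖f w‖) 1 := fun w => by simp [h1 w]
  have hn2 : Function.Periodic (fun w => ‖f w‖) ω := fun w => by simp [h2 w]
  have hb : ∀ w, ‖f w‖ ≤ C := by
    intro w
    set b : ℝ := w.im / ω.im with hb
    set a : ℝ := (w - b * ω).re with ha
    have hw : w = a + b * ω := by
      apply Complex.ext
      · simp [ha]
      · simp [hb, div_mul_cancel₀ _ hω.ne']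
    have h3 : ‖f (w - ⌊a⌋ • (1 : ℂ))‖ = ‖f w‖ := hn1.sub_zsmul_eq ⌊a⌋
    have h4 : ‖f (w - ⌊a⌋ • (1 : ℂ) - ⌊b⌋ • ω)‖ = ‖f (w - ⌊a⌋ • (1 : ℂ))‖ := hn2.sub_zsmul_eq ⌊b⌋
    rw [← h3, ← h4]
    refine hC _ ⟨(Int.fract a, Int.fract b), ⟨⟨Int.fract_nonneg a, (Int.fract_lt_one a).le⟩,
      Int.fract_nonneg b, (Int.fract_lt_one b).le⟩, ?_⟩
    simp only [Int.fract, zsmul_eq_mul]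
    push_cast
    linear_combination -hw
  have hbd : Bornology.IsBounded (Set.range f) :=
    (Metric.isBounded_closedBall (x := (0 : ℂ)) (r := C)).subset (by
      rintro _ ⟨w, rfl⟩
      simpa using hb w)
  have h3 := hf.apply_eq_apply_of_bounded hbd (u + 1) u
  rw [h1 u] at h3
  exact self_eq_neg.mp h3.symm

/-- A variant of `eq_zero_of_antiperiodic_of_periodic` allowing isolated removable
singularities. -/
lemma eq_zero_of_removable_of_antiperiodic_of_periodic {G : ℂ → ℂ} {ω : ℂ} (hω : 0 < ω.im)
    (hd : ∀ u, ∀ᶠ w in 𝓝[≠] u, DifferentiableAt ℂ G w)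
    (hlim : ∀ u, ∃ L, Tendsto G (𝓝[≠] u) (𝓝 L))
    (h1 : Function.Antiperiodic G 1) (h2 : Function.Periodic G ω) {u : ℂ}
    (hu : ContinuousAt G u) : G u = 0 := by
  choose F hF using hlim
  have hFG : ∀ w, ContinuousAt G w → F w = G w := fun w hw =>
    tendsto_nhds_unique (hF w) (hw.tendsto.mono_left nhdsWithin_le_nhds)
  have hFd : Differentiable ℂ F := by
    intro v
    have hd' : ∀ᶠ w in 𝓝[≠] v, DifferentiableAt ℂ (Function.update G v (F v)) w := by
      filter_upwards [hd v, self_mem_nhdsWithin] with w hw hwv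
      refine hw.congr_of_eventuallyEq ?_
      filter_upwards [eventually_ne_nhds hwv] with x hx
      exact Function.update_of_ne hx _ _
    have h := (Complex.analyticAt_of_differentiable_on_punctured_nhds_of_continuousAt hd'
      (continuousAt_update_same.mpr (hF v))).differentiableAt
    refine h.congr_of_eventuallyEq ?_
    filter_upwards [eventually_nhdsWithin_iff.mp (hd v)] with w hw
    by_cases hwv : w = v
    · rw [hwv, Function.update_self]
    · rw [Function.update_of_ne hwv, hFG w (hw hwv).continuousAt]
  have hF1 : Function.Antiperiodic F 1 := fun v =>
    tendsto_nhds_unique ((hF (v + 1)).comp (tendsto_add_nhdsNE v 1))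
      ((hF v).neg.congr fun w => (h1 w).symm)
  have hF2 : Function.Periodic F ω := fun v =>
    tendsto_nhds_unique ((hF (v + ω)).comp (tendsto_add_nhdsNE v ω))
      ((hF v).congr fun w => (h2 w).symm)
  rw [← hFG u hu]
  exact eq_zero_of_antiperiodic_of_periodic hω hFd hF1 hF2 u

/-- An even function whose singularity at `0` is weaker than a double pole has a removable
singularity there. -/
lemma exists_tendsto_of_even_of_tendsto_sq_mul {G : ℂ → ℂ}
    (hd : ∀ᶠ w in 𝓝[≠] 0, DifferentiableAt ℂ G w) (hG : ∀ w, G (-w) = G w)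
    (h : Tendsto (fun w => w ^ 2 * G w) (𝓝[≠] 0) (𝓝 0)) :
    ∃ L, Tendsto G (𝓝[≠] 0) (𝓝 L) := by
  have hne : ∀ᶠ w : ℂ in 𝓝[≠] 0, (w - 0)⁻¹ = 0 → False := by
    filter_upwards [self_mem_nhdsWithin] with w hw h
    exact hw (by simpa using h)
  have hid : Tendsto (fun w : ℂ => w) (𝓝[≠] 0) (𝓝 0) := tendsto_id.mono_left nhdsWithin_le_nhds
  have hneg : Tendsto (fun w : ℂ => -w) (𝓝[≠] 0) (𝓝[≠] 0) := by
    refine tendsto_nhdsWithin_iff.mpr ⟨by simpa using hid.neg, ?_⟩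
    filter_upwards [self_mem_nhdsWithin] with w hw h
    exact hw (neg_eq_zero.mp h)
  have h1 := Complex.tendsto_limUnder_of_differentiable_on_punctured_nhds_of_isLittleO
    (f := fun w => w * G w) (c := 0) (by
      filter_upwards [hd] with w hw
      exact differentiableAt_id.mul hw)
    ((Asymptotics.isLittleO_iff_tendsto' (hne.mono fun w hw h => (hw h).elim)).mpr
      (h.congr fun w => by
        rw [zero_mul, sub_zero, sub_zero, div_inv_eq_mul]
        ring))
  set a := limUnder (𝓝[≠] 0) fun w => w * G w
  have h2 : a = -a := tendsto_nhds_unique h1 <| by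
    have := (h1.comp hneg).neg
    refine this.congr fun w => ?_
    simp [hG]
  rw [self_eq_neg.mp h2] at h1
  refine ⟨_, Complex.tendsto_limUnder_of_differentiable_on_punctured_nhds_of_isLittleO hd
    ((Asymptotics.isLittleO_iff_tendsto' (hne.mono fun w hw h => (hw h).elim)).mpr ?_)⟩
  have h3 := h1.sub (hid.mul_const (G 0))
  rw [zero_mul, sub_zero] at h3
  refine h3.congr fun w => ?_
  rw [sub_zero, div_inv_eq_mul]
  ring

/-- The difference of the two sides of the heat-operator identity, divided by
`jTheta u (2τ) ^ 2` and set to zero where `jTheta u (2τ)` vanishes. -/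
def heatDefect (τ : ℂ) : ℂ → ℂ :=
  Set.indicator {u | ∀ n, appellArg τ u n ≠ 1} fun u =>
    jTheta u (2 * τ) * appellHeatQuot τ u +
      I * (dedekindEta (2 * τ) ^ 8 / dedekindEta τ) * jTheta (u + 1 / 2) τ / jTheta u (2 * τ) ^ 2

lemma heatDefect_of_ne {τ u : ℂ} (hu : ∀ n, appellArg τ u n ≠ 1) :
    heatDefect τ u = jTheta u (2 * τ) * appellHeatQuot τ u +
      I * (dedekindEta (2 * τ) ^ 8 / dedekindEta τ) * jTheta (u + 1 / 2) τ /
        jTheta u (2 * τ) ^ 2 :=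
  Set.indicator_of_mem (s := {u | ∀ n, appellArg τ u n ≠ 1}) hu _

lemma heatDefect_of_not {τ u : ℂ} (hu : ¬ ∀ n, appellArg τ u n ≠ 1) : heatDefect τ u = 0 :=
  Set.indicator_of_notMem (s := {u | ∀ n, appellArg τ u n ≠ 1}) hu _

lemma antiperiodic_heatDefect (τ : ℂ) : Function.Antiperiodic (heatDefect τ) 1 := by
  intro u
  by_cases hu : ∀ n, appellArg τ u n ≠ 1
  · rw [heatDefect_of_ne hu, heatDefect_of_ne fun n => by rw [appellArg_add_one]; exact hu n,
      appellHeatQuot_add_one, jTheta_add_one, add_right_comm, jTheta_add_one]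
    ring
  · rw [heatDefect_of_not hu, heatDefect_of_not, neg_zero]
    simpa only [appellArg_add_one] using hu

lemma periodic_heatDefect {τ : ℂ} (hτ : 0 < τ.im) :
    Function.Periodic (heatDefect τ) (2 * τ) := by
  intro u
  have hiff : (∀ n, appellArg τ (u + 2 * τ) n ≠ 1) ↔ ∀ n, appellArg τ u n ≠ 1 := by
    simp only [appellArg_add_period]
    exact ⟨fun h n => by simpa using h (n - 1), fun h n => h _⟩
  by_cases hu : ∀ n, appellArg τ u n ≠ 1
  · have h0 := jTheta_two_mul_ne_zero hτ hu
    set e := Complex.exp (2 * π * I * (τ + u)) with he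
    have he0 : e ≠ 0 := Complex.exp_ne_zero _
    have h1 : jTheta (u + 2 * τ) (2 * τ) = -(e⁻¹ * jTheta u (2 * τ)) := by
      rw [jTheta_add_period, he, ← Complex.exp_neg]
      ring_nf
    have h2 : jTheta (u + 2 * τ + 1 / 2) τ = e⁻¹ ^ 2 * jTheta (u + 1 / 2) τ := by
      rw [show u + 2 * τ + 1 / 2 = u + 1 / 2 + τ + τ by ring, jTheta_add_period, jTheta_add_period,
        mul_neg, neg_neg, ← mul_assoc, ← Complex.exp_add, he, ← Complex.exp_neg,
        ← Complex.exp_nat_mul]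
      congr 1
      rw [Complex.exp_eq_exp_iff_exists_int]
      exact ⟨-1, by push_cast; ring⟩
    rw [heatDefect_of_ne hu, heatDefect_of_ne (hiff.mpr hu), h1, h2,
      appellHeatQuot_add_period hτ hu, ← he]
    field_simp
  · rw [heatDefect_of_not hu, heatDefect_of_not (hiff.not.mpr hu)]

lemma heatDefect_neg {τ : ℂ} (hτ : 0 < τ.im) (u : ℂ) : heatDefect τ (-u) = heatDefect τ u := by
  by_cases hu : ∀ n, appellArg τ u n ≠ 1
  · have h1 : jTheta (-u + 1 / 2) τ = jTheta (u + 1 / 2) τ := by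
      have h := jTheta_add_one (u - 1 / 2) τ
      rw [← jTheta_neg] at h
      rw [show u + 1 / 2 = u - 1 / 2 + 1 by ring, h]
      ring_nf
    rw [heatDefect_of_ne hu, heatDefect_of_ne (appellArg_neg_ne_one hu),
      appellHeatQuot_neg hτ hu, h1, jTheta_neg]
    ring
  · rw [heatDefect_of_not hu, heatDefect_of_not]
    intro h
    apply hu
    simpa using appellArg_neg_ne_one h

lemma differentiableAt_heatDefect {τ u : ℂ} (hτ : 0 < τ.im) (hu : ∀ n, appellArg τ u n ≠ 1) :
    DifferentiableAt ℂ (heatDefect τ) u := by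
  have hτ' : 0 < (2 * τ).im := by simpa using hτ
  have h1 := (differentiable_jTheta hτ').differentiableAt (x := u)
  have h2 : DifferentiableAt ℂ (fun w => jTheta (w + 1 / 2) τ) u :=
    ((differentiable_jTheta hτ).comp (differentiable_id.add_const (1 / 2))).differentiableAt
  refine DifferentiableAt.congr_of_eventuallyEq
    ((h1.mul (differentiableAt_appellHeatQuot hτ hu)).add
      ((h2.const_mul (I * (dedekindEta (2 * τ) ^ 8 / dedekindEta τ))).div (h1.pow 2)
        (pow_ne_zero 2 (jTheta_two_mul_ne_zero hτ hu)))) ?_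
  filter_upwards [eventually_appellArg_ne_one hτ hu] with w hw
  exact heatDefect_of_ne hw

lemma tendsto_sq_mul_heatDefect {τ : ℂ} (hτ : 0 < τ.im) :
    Tendsto (fun u => u ^ 2 * heatDefect τ u) (𝓝[≠] 0) (𝓝 0) := by
  have he := dedekindEta_ne_zero hτ
  have hE : dedekindEta (2 * τ) ≠ 0 := dedekindEta_ne_zero (by simpa using hτ)
  have hpi : (π : ℂ) ≠ 0 := by exact_mod_cast Real.pi_pos.ne'
  have h1 := tendsto_jTheta_two_mul_div hτ
  have h2 := tendsto_pow_mul_appellHeatQuot hτ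
  have h3 : Tendsto (fun u => jTheta (u + 1 / 2) τ) (𝓝[≠] 0) (𝓝 (jTheta (1 / 2) τ)) :=
    (((differentiable_jTheta hτ).continuous.comp (continuous_add_const (1 / 2))).tendsto' 0 _
      (by simp)).mono_left nhdsWithin_le_nhds
  have hlim := (h1.mul h2).add ((h3.const_mul
    (I * (dedekindEta (2 * τ) ^ 8 / dedekindEta τ))).div (h1.pow 2)
      (by simp [hpi, hE]))
  have hval : (-2 * π * dedekindEta (2 * τ) ^ 3 : ℂ) *
      (2 * (-(2 * π * I)⁻¹) ^ 3 / altTheta τ) +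
      I * (dedekindEta (2 * τ) ^ 8 / dedekindEta τ) * jTheta (1 / 2) τ /
        (-2 * π * dedekindEta (2 * τ) ^ 3) ^ 2 = 0 := by
    rw [eq_div_of_mul_eq hE (altTheta_mul_dedekindEta hτ), eq_div_of_mul_eq he (jTheta_half hτ)]
    field_simp
    linear_combination dedekindEta (2 * τ) ^ 4 * (1 - I ^ 2) * Complex.I_sq
  rw [hval] at hlim
  refine hlim.congr' ?_
  filter_upwards [eventually_nhdsNE_appellArg_ne_one hτ 0, self_mem_nhdsWithin] with u hu hu0
  have hu0 : u ≠ 0 := hu0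
  have := jTheta_two_mul_ne_zero hτ hu
  rw [heatDefect_of_ne hu, Pi.div_apply]
  field_simp

lemma exists_tendsto_heatDefect {τ : ℂ} (hτ : 0 < τ.im) (u : ℂ) :
    ∃ L, Tendsto (heatDefect τ) (𝓝[≠] u) (𝓝 L) := by
  by_cases hu : ∀ n, appellArg τ u n ≠ 1
  · exact ⟨_, (differentiableAt_heatDefect hτ hu).continuousAt.tendsto.mono_left
      nhdsWithin_le_nhds⟩
  · obtain ⟨L, hL⟩ := exists_tendsto_of_even_of_tendsto_sq_mul
      ((eventually_nhdsNE_appellArg_ne_one hτ 0).mono fun w hw =>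
        differentiableAt_heatDefect hτ hw) (heatDefect_neg hτ) (tendsto_sq_mul_heatDefect hτ)
    push Not at hu
    obtain ⟨n, hn⟩ := hu
    obtain ⟨m, hm⟩ := Complex.exp_eq_one_iff.mp hn
    have hum : u = m * 1 - n * (2 * τ) := by
      have := mul_left_cancel₀ Complex.two_pi_I_ne_zero (hm.trans (mul_comm _ _))
      linear_combination this
    have h1 := hL.comp ((tendsto_add_nhdsNE u (-u)).trans (by rw [add_neg_cancel]))
    refine ⟨_, (h1.const_mul ((m.negOnePow : ℤ) : ℂ)).congr fun w => ?_⟩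
    have h2 := (antiperiodic_heatDefect τ).add_int_mul_eq (x := w + -u) m
    have h3 := (periodic_heatDefect hτ).sub_int_mul_eq (x := w + -u + m * 1) n
    rw [Function.comp_apply, ← h2, ← h3]
    congr 1
    rw [hum]
    ring

/-- The heat-operator identity in terms of Appell sums. -/
lemma jTheta_pow_mul_appellHeatQuot {τ u : ℂ} (hτ : 0 < τ.im)
    (hu : ∀ n, appellArg τ u n ≠ 1) :
    jTheta u (2 * τ) ^ 3 * appellHeatQuot τ u =
      -(I * (dedekindEta (2 * τ) ^ 8 / dedekindEta τ) * jTheta (u + 1 / 2) τ) := by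
  have h0 := jTheta_two_mul_ne_zero hτ hu
  have h := eq_zero_of_removable_of_antiperiodic_of_periodic (ω := 2 * τ) (by simpa using hτ)
    (fun v => (eventually_nhdsNE_appellArg_ne_one hτ v).mono fun w hw =>
      differentiableAt_heatDefect hτ hw) (exists_tendsto_heatDefect hτ)
    (antiperiodic_heatDefect τ) (periodic_heatDefect hτ)
    (differentiableAt_heatDefect hτ hu).continuousAt
  rw [heatDefect_of_ne hu] at h
  field_simp at h ⊢
  linear_combination h

lemma jTheta_self_two_mul (t : ℂ) :
    jTheta t (2 * t) = -I * Complex.exp (-π * I * t / 2) * altTheta t := by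
  rw [altTheta, ← (Equiv.addRight (1 : ℤ)).tsum_eq, jTheta, ← tsum_mul_left]
  refine tsum_congr fun n => ?_
  have h1 : (-1 : ℂ) ^ (n + 1) = Complex.exp (π * I * (n + 1)) := by
    rw [← Complex.exp_pi_mul_I, ← Complex.exp_int_mul]
    push_cast
    ring_nf
  have h2 : -I = Complex.exp (-(π / 2 * I)) := by
    rw [Complex.exp_neg, Complex.exp_pi_div_two_mul_I, Complex.inv_I]
  rw [Equiv.coe_addRight, h1, h2, ← Complex.exp_add, ← Complex.exp_add, ← Complex.exp_add]
  congr 1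
  push_cast
  ring

lemma exp_mul_lerchMu_eq (u t : ℂ) :
    Complex.exp (-π * I * t / 2) * Complex.exp (π * I * u) * lerchMu u t (2 * t) =
      I * (appell t u / altTheta t) := by
  have h : Complex.exp (π * I * u) ^ 2 * ∑' n : ℤ, (-1 : ℂ) ^ n *
      Complex.exp (π * I * ((n : ℂ) ^ 2 + (n : ℂ)) * (2 * t) + 2 * π * I * t * (n : ℂ)) /
      (1 - Complex.exp (2 * π * I * (n : ℂ) * (2 * t) + 2 * π * I * u)) = appell t u := by
    rw [appell, appellSum, ← tsum_mul_left]
    refine tsum_congr fun n => ?_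
    have h1 : Complex.exp (2 * π * I * (n : ℂ) * (2 * t) + 2 * π * I * u) = appellArg t u n := by
      rw [appellArg]
      ring_nf
    have h2 : Complex.exp (π * I * u) ^ 2 *
        Complex.exp (π * I * ((n : ℂ) ^ 2 + (n : ℂ)) * (2 * t) + 2 * π * I * t * (n : ℂ)) =
        Complex.exp (2 * π * I * n ^ 2 * t) * appellArg t u n := by
      rw [appellArg, ← Complex.exp_nat_mul, ← Complex.exp_add, ← Complex.exp_add]
      push_cast
      ring_nf
    rw [h1, thetaCoeff, geomFrac, pow_zero, one_mul, id]
    linear_combination (-1 : ℂ) ^ n / (1 - appellArg t u n) * h2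
  rw [lerchMu, jTheta_self_two_mul, ← h]
  have h0 := Complex.exp_ne_zero (-π * I * t / 2)
  rw [div_eq_mul_inv _ (-I * _ * _), mul_inv, mul_inv, inv_neg, Complex.inv_I, neg_neg]
  generalize (∑' n : ℤ, _ : ℂ) = S
  linear_combination Complex.exp (π * I * u) ^ 2 * I * (altTheta t)⁻¹ * S * mul_inv_cancel₀ h0

lemma hasDerivAt_altTheta {τ : ℂ} (hτ : 0 < τ.im) {u : ℂ} (hu : ∀ n, appellArg τ u n ≠ 1) :
    HasDerivAt altTheta (2 * π * I * altThetaDeriv τ) τ := by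
  have h := hasDerivAt_appellSum_fst (P := fun _ => 1) (by fun_prop) hτ hu
  simp only [appellSum_zero_one] at h
  refine h.congr_deriv ?_
  simp [appellSum, altThetaDeriv]

lemma hasDerivAt_appell_fst {τ u : ℂ} (hτ : 0 < τ.im) (hu : ∀ n, appellArg τ u n ≠ 1) :
    HasDerivAt (fun t => appell t u) (2 * π * I * (appellSum 2 id τ u +
      2 * appellSum 1 (fun x => x * (1 + x)) τ u)) τ := by
  simpa [appell] using hasDerivAt_appellSum_fst differentiable_id hτ hu

lemma iteratedDeriv_two_appell_snd {τ u : ℂ} (hτ : 0 < τ.im) (hu : ∀ n, appellArg τ u n ≠ 1) :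
    iteratedDeriv 2 (appell τ) u =
      (2 * π * I) ^ 2 * appellSum 0 (fun x => (1 + 2 * x) * (x * (1 + x))) τ u := by
  have h1 : ∀ w, (∀ n, appellArg τ w n ≠ 1) → HasDerivAt (appell τ)
      (2 * π * I * appellSum 0 (fun x => x * (1 + x)) τ w) w := fun w hw => by
    have h := hasDerivAt_appellSum_snd 0 differentiable_id hτ hw
    simp only [deriv_id, one_mul] at h
    exact h
  have h2 : deriv (appell τ) =ᶠ[𝓝 u]
      fun w => 2 * π * I * appellSum 0 (fun x => x * (1 + x)) τ w :=
    (eventually_appellArg_ne_one hτ hu).mono fun w hw => (h1 w hw).deriv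
  have h3 := (hasDerivAt_appellSum_snd 0 (P := fun x => x * (1 + x)) (by fun_prop) hτ hu).const_mul
    (2 * π * I)
  have h4 : deriv (fun x : ℂ => x * (1 + x)) = fun x => 1 + 2 * x := by
    funext x
    refine (((hasDerivAt_id x).mul ((hasDerivAt_id x).const_add 1)).congr_deriv ?_).deriv
    simp only [id]
    ring
  rw [iteratedDeriv_succ, iteratedDeriv_one, h2.deriv_eq, h3.deriv, h4]
  ring

/-- The heat-operator form of the M2-rank for overpartitions PDE. -/
theorem m2_overpartition_pde_heat (τ u : ℂ) (hτ : 0 < τ.im)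
    (hu : ∀ m n : ℤ, u ≠ 2 * (m : ℂ) * τ + (n : ℂ)) :
    jTheta u (2 * τ) ^ 3 *
      (2 * π * I * deriv (fun t : ℂ =>
          Complex.exp (-π * I * t / 2) * Complex.exp (π * I * u) * lerchMu u t (2 * t)) τ
        + iteratedDeriv 2 (fun w : ℂ =>
          Complex.exp (-π * I * τ / 2) * Complex.exp (π * I * w) * lerchMu w τ (2 * τ)) u)
    = -4 * π^2 * (dedekindEta (2 * τ) ^ 8 / dedekindEta τ) * jTheta (u + 1/2) τ := by
  have hu' := appellArg_ne_one hu
  have hθ := altTheta_ne_zero hτ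
  simp only [exp_mul_lerchMu_eq]
  have h1 := (((hasDerivAt_appell_fst hτ hu').div (hasDerivAt_altTheta hτ hu') hθ).const_mul I).deriv
  simp only [Pi.div_apply] at h1
  have h2 : iteratedDeriv 2 (fun w => I * (appell τ w / altTheta τ)) u =
      I / altTheta τ * iteratedDeriv 2 (appell τ) u := by
    rw [← iteratedDeriv_const_mul_field]
    congr 1
    funext w
    ring
  have h3 : 2 * π * I * deriv (fun t : ℂ => I * (appell t u / altTheta t)) τ +
      iteratedDeriv 2 (fun w : ℂ => I * (appell τ w / altTheta τ)) u =
      -4 * π ^ 2 * I * appellHeatQuot τ u := by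
    rw [h2, iteratedDeriv_two_appell_snd hτ hu', h1, appellHeatQuot, appellHeat]
    field_simp
    rw [Complex.I_sq]
    ring
  rw [h3]
  linear_combination -4 * π ^ 2 * I * jTheta_pow_mul_appellHeatQuot hτ hu' +
    4 * π ^ 2 * (dedekindEta (2 * τ) ^ 8 / dedekindEta τ) * jTheta (u + 1 / 2) τ * Complex.I_sq

end
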